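/- arXiv:2506.23064 — 3 statements merged into one kernel-verified Lean document; each statement's English description precedes it below -/
import Mathlib

section
/- Let λ ∈ ℂ, let a, N be natural numbers, and let m be an integer with m > N and a ≥ m−N. Then the following three conditions are equivalent: (i) Ξ(λ,a,N,m) ≠ {0}; (ii) dim_ℂ Ξ(λ,a,N,m) = 1; (iii) λ ∈ Λ(N,a,m). -/
noncomputable section

open Polynomial Finset

/-- The space `Pol_b[t]_even`: span of the monomials `t^(b-2i)`, `0 ≤ i ≤ ⌊b/2⌋`
(zero space when `b < 0`). -/
def polEven (b : ℤ) (f : ℂ[X]) : Prop :=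
  ∀ n : ℕ, f.coeff n ≠ 0 → (n : ℤ) ≤ b ∧ (2 : ℤ) ∣ (b - n)

/-- Imaginary Gegenbauer operator `S_ℓ^μ`. -/
def gegenS (μ : ℂ) (ℓ : ℤ) (f : ℂ[X]) : ℂ[X] :=
  -((1 + X ^ 2) * derivative (derivative f)
      + (1 + 2 * C μ) * X * derivative f
      - C ((ℓ : ℂ) * ((ℓ : ℂ) + 2 * μ)) * f)

/-- Euler operator `ϑ_t`. -/
def euler (f : ℂ[X]) : ℂ[X] := X * derivative f

/-- Renormalized Gegenbauer polynomial `C̃_n^μ(z)` for a natural number degree `n`. -/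
def gegenC (μ : ℂ) (n : ℕ) : ℂ[X] :=
  ∑ k ∈ range (n / 2 + 1),
    C ((-1 : ℂ) ^ k / ((k.factorial : ℂ) * ((n - 2 * k).factorial : ℂ)) *
        ∏ s ∈ range (n / 2 - k), (μ + (((n + 1) / 2 : ℕ) : ℂ) + (s : ℂ))) *
      (C 2 * X) ^ (n - 2 * k)

/-- `C̃_ℓ^μ(z)` for `ℓ : ℤ` (zero for `ℓ < 0`). -/
def gegenCZ (μ : ℂ) (ℓ : ℤ) : ℂ[X] := if 0 ≤ ℓ then gegenC μ ℓ.toNat else 0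

/-- `C̃_ℓ^μ(it)`: substitution `z = it`. -/
def gegenCit (μ : ℂ) (ℓ : ℤ) : ℂ[X] := (gegenCZ μ ℓ).comp (C Complex.I * X)

/-- `γ(μ, ℓ)`. -/
def gam (μ : ℂ) (ℓ : ℤ) : ℂ := if ℓ % 2 = 0 then μ + ((ℓ / 2 : ℤ) : ℂ) else 1

/-- `Γ(x+k)/Γ(x)` interpreted as a finite product (reciprocal for `k < 0`). -/
def gratio (x : ℂ) (k : ℤ) : ℂ :=
  if 0 ≤ k then ∏ i ∈ range k.toNat, (x + (i : ℂ))
  else (∏ i ∈ range (-k).toNat, (x + (k : ℂ) + (i : ℂ)))⁻¹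

/-- `Γ(z₁)/Γ(z₂)` at integer arguments, as a finite product. -/
def gq (z₁ z₂ : ℤ) : ℂ := gratio (z₂ : ℂ) (z₁ - z₂)

/-- The set `Λ(N,a,m)`, regarded as a subset of `ℂ`. -/
def LambdaSet (N a : ℕ) (m : ℤ) : Set ℂ :=
  { x | ∃ q : ℤ, max 0 ((N : ℤ) - a + m) ≤ q ∧ q ≤ 2 * N ∧
      x = (N : ℂ) + 1 - (a : ℂ) - (q : ℂ) }

/-- The set `M_ℓ^k`, regarded as a subset of `ℂ`. -/
def Mset (ℓ k : ℤ) : Set ℂ :=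
  { x | ∃ d : ℤ, 0 ≤ d ∧ d ≤ ℓ / 2 - k - 1 ∧ x = -(((ℓ + 1) / 2 : ℤ) : ℂ) - (d : ℂ) }

/-- The solution space `Ξ(λ,a,N,m)` of the system (A_j^±), (B_j^±), realized as
the set of tuples `(f_{-N},…,f_N)`, encoded as functions `ℤ → ℂ[X]` vanishing for `|j| > N`. -/
def XiSet (lam : ℂ) (a N : ℕ) (m : ℤ) : Set (ℤ → ℂ[X]) :=
  { f |
    (∀ j : ℤ, (N : ℤ) < |j| → f j = 0) ∧
    (∀ j : ℤ, |j| ≤ (N : ℤ) → polEven ((a : ℤ) - m + j) (f j)) ∧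
    (∀ j : ℤ, 0 ≤ j → j ≤ (N : ℤ) →
      gegenS (lam + (j : ℂ) - 1) ((a : ℤ) + m - j) (f j)
        - C (2 * ((N : ℂ) - (j : ℂ))) * derivative (f (j + 1)) = 0) ∧
    (∀ j : ℤ, 0 ≤ j → j ≤ (N : ℤ) →
      gegenS (lam + (j : ℂ) - 1) ((a : ℤ) - m - j) (f (-j))
        + C (2 * ((N : ℂ) - (j : ℂ))) * derivative (f (-j - 1)) = 0) ∧
    (∀ j : ℤ, 1 ≤ j → j ≤ (N : ℤ) →
      C (2 * (-(m : ℂ)) * (lam + (a : ℂ) - 1)) * f j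
        + C (2 * (j : ℂ)) * (C (lam - 1) * f j + euler (f j))
        + C ((N : ℂ) - (j : ℂ)) * derivative (f (j + 1))
        + C ((N : ℂ) + (j : ℂ)) * derivative (f (j - 1)) = 0) ∧
    (∀ j : ℤ, 1 ≤ j → j ≤ (N : ℤ) →
      C (2 * (m : ℂ) * (lam + (a : ℂ) - 1)) * f (-j)
        + C (2 * (j : ℂ)) * (C (lam - 1) * f (-j) + euler (f (-j)))
        - C ((N : ℂ) + (j : ℂ)) * derivative (f (-j + 1))
        - C ((N : ℂ) - (j : ℂ)) * derivative (f (-j - 1)) = 0) }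

/-- The constant `C_{j,r}^+`. -/
def Cp (lam : ℂ) (a N : ℕ) (m : ℤ) (j r : ℕ) : ℂ :=
  ((N - j).choose r : ℂ) * (((2 * N - r).factorial : ℂ) / ((N + j).factorial : ℂ)) *
    (∏ i ∈ range r, ((N : ℂ) - (m : ℂ) - (i : ℂ))) *
    (∏ i ∈ range r, (lam + (a : ℂ) - (N : ℂ) - 1 + (i : ℂ)))

/-- The constant `C_{j,r}^-`. -/
def Cm (lam : ℂ) (a N : ℕ) (m : ℤ) (j r : ℕ) : ℂ :=
  ((N - j).choose r : ℂ) * (((2 * N - r).factorial : ℂ) / ((N + j).factorial : ℂ)) *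
    (∏ i ∈ range r, ((N : ℂ) + (m : ℂ) - (i : ℂ))) *
    (∏ i ∈ range r, (lam + (a : ℂ) - (N : ℂ) - 1 + (i : ℂ)))

/-- The gamma factor `Γ_j^+`. -/
def GammaP (lam : ℂ) (a N : ℕ) (m : ℤ) (j : ℕ) : ℂ :=
  ∏ d ∈ range (N - j), gam (lam + (N : ℂ) - 1) ((a : ℤ) + m - (N : ℤ) - ((d : ℤ) + 1))

/-- The gamma factor `Γ_j^-`. -/
def GammaM (lam : ℂ) (a N : ℕ) (m : ℤ) (j : ℕ) : ℂ :=
  ∏ d ∈ range (N - j), gam (lam + (N : ℂ) - 1) ((a : ℤ) - m - (N : ℤ) - ((d : ℤ) + 1))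

/-- The constant `D_{j,r}` (with parameter `q`). -/
def Dc (N : ℕ) (m q : ℤ) (j r : ℕ) : ℂ :=
  ((N - j).choose r : ℂ) * (((2 * N - r).factorial : ℂ) / ((N + j).factorial : ℂ)) *
    (∏ i ∈ range r, ((N : ℂ) + (m : ℂ) - (i : ℂ))) *
    (∏ i ∈ range r, ((q : ℂ) - 2 * (N : ℂ) + (i : ℂ)))

/-- Binomial coefficient with integer upper argument: `binom(x,k) = (∏_{i<k}(x-i))/k!`. -/
def zbinom (x : ℤ) (k : ℕ) : ℂ := (∏ i ∈ range k, ((x : ℂ) - (i : ℂ))) / (k.factorial : ℂ)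

/-- The gamma factor `Γ(d,r)` of the paper (for integral `λ = λz`, `ν = νz`). -/
def GammaAB (N : ℕ) (m lamz nuz : ℤ) (d r : ℕ) : ℂ :=
  (d.choose r : ℂ) *
    gq (lamz + (nuz - lamz - m + (N : ℤ) - (d : ℤ) - 1) / 2)
       (lamz + (nuz - lamz - m - 1) / 2) *
    (((2 * N - r).factorial : ℂ) / (N.factorial : ℂ)) *
    (∏ i ∈ range r, ((N : ℂ) + (m : ℂ) - (i : ℂ)))

/-- The constant `A(d,r)` of the paper (for integral `λ = λz`, `ν = νz`). -/
def Acoef (N : ℕ) (m lamz nuz : ℤ) (d r : ℕ) : ℂ :=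
  (-1 : ℂ) ^ (nuz - 1) * GammaAB N m lamz nuz d r *
    gq (lamz + (-nuz - lamz - m + (N : ℤ) - (d : ℤ) + 1) / 2)
       (lamz + (nuz - lamz - m + (N : ℤ) - (d : ℤ) - 1) / 2) *
    ∏ i ∈ range r, ((N : ℂ) + (nuz : ℂ) - ((i : ℂ) + 1))

/-- The constant `B(d,r)` of the paper (for integral `λ = λz`, `ν = νz`). -/
def Bcoef (N : ℕ) (m lamz nuz : ℤ) (d r : ℕ) : ℂ :=
  (-1 : ℂ) ^ ((d : ℤ) - (N : ℤ)) * GammaAB N m lamz nuz (2 * N - d) r *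
    ∏ i ∈ range r, ((N : ℂ) - (nuz : ℂ) + 2 - ((i : ℂ) + 1))

/-- The predicate `(E_j^+)` on `f_j`. -/
def Eplus (lam : ℂ) (a N : ℕ) (m : ℤ) (qp : ℂ) (j : ℕ) (fj : ℂ[X]) : Prop :=
  C ((-Complex.I) ^ (N - j) * (((2 * N).factorial : ℂ) / ((N + j).factorial : ℂ)) *
      GammaP lam a N m j) * fj
    = C qp * ∑ r ∈ range (N - j + 1),
        C (Cp lam a N m j r) *
          gegenCit (lam + (N : ℂ) - 1 - (r : ℂ)) ((a : ℤ) + m - 2 * (N : ℤ) + (j : ℤ) + 2 * (r : ℤ))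

/-- The predicate `(E_j^-)` on `f_{-j}`. -/
def Eminus (lam : ℂ) (a N : ℕ) (m : ℤ) (qm : ℂ) (j : ℕ) (fj : ℂ[X]) : Prop :=
  C (Complex.I ^ (N - j) * (((2 * N).factorial : ℂ) / ((N + j).factorial : ℂ)) *
      GammaM lam a N m j) * fj
    = C qm * ∑ r ∈ range (N - j + 1),
        C (Cm lam a N m j r) *
          gegenCit (lam + (N : ℂ) - 1 - (r : ℂ)) ((a : ℤ) - m - 2 * (N : ℤ) + (j : ℤ) + 2 * (r : ℤ))

/-- The constant `C_{0,r}(m')` with integer parameter `a`. -/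
def C0r (lam : ℂ) (N : ℕ) (a m' : ℤ) (r : ℕ) : ℂ :=
  (N.choose r : ℂ) * (((2 * N - r).factorial : ℂ) / (N.factorial : ℂ)) *
    (∏ i ∈ range r, ((N : ℂ) - (m' : ℂ) - (i : ℂ))) *
    (∏ i ∈ range r, (lam + (a : ℂ) - (N : ℂ) - 1 + (i : ℂ)))

/-- `α(λ,N,a,m')`. -/
def alphaF (lam : ℂ) (N : ℕ) (a m' : ℤ) : ℂ :=
  ∑ r ∈ range (N + 1), (-1 : ℂ) ^ r * C0r lam N a m' r *
    ∏ i ∈ range (N - r), ((((a + m') / 2 : ℤ) : ℂ) - ((i : ℂ) + 1))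

/-- `β(λ,N,a,m')`. -/
def betaF (lam : ℂ) (N : ℕ) (a m' : ℤ) : ℂ :=
  ∑ r ∈ range (N + 1), (-1 : ℂ) ^ r * C0r lam N a m' r *
    ∏ i ∈ range (N - r), ((((a + m' + 2) / 2 : ℤ) : ℂ) - ((i : ℂ) + 1))

/-- The polynomial function `P(λ)`. -/
def Pf (N : ℕ) (a m : ℤ) (lam : ℂ) : ℂ :=
  (lam + (((a + m - 1) / 2 : ℤ) : ℂ)) * (((a + m) / 2 : ℤ) : ℂ) *
      alphaF lam N a m * betaF lam N a (-m)
    - (lam + (((a - m - 1) / 2 : ℤ) : ℂ)) * (((a - m) / 2 : ℤ) : ℂ) *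
      alphaF lam N a (-m) * betaF lam N a m

/-- The polynomial function `Q(λ)`. -/
def Qf (N : ℕ) (a m : ℤ) (lam : ℂ) : ℂ :=
  (∏ i ∈ range (N + 1), ((m : ℂ) + (i : ℂ))) *
    (∏ i ∈ range N, (((i : ℂ) + 1) - (m : ℂ))) *
    ∏ q ∈ range (2 * N + 1), (lam - (N : ℂ) - 1 + (a : ℂ) + (q : ℂ))

/-- `α̃(a,m')`. -/
def alphaTilde (N q : ℕ) (a m' : ℤ) : ℂ :=
  ∑ r ∈ range (min q N + 1),
    (N.choose r : ℂ) * (((2 * N - r).factorial : ℂ) / ((2 * N - q).factorial : ℂ)) *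
      ((q.factorial : ℂ) / ((q - r).factorial : ℂ)) *
      (∏ i ∈ range r, ((N : ℂ) - (m' : ℂ) - (i : ℂ))) *
      (∏ i ∈ Finset.Ico r q, ((((a + m') / 2 : ℤ) : ℂ) - (N : ℂ) + (i : ℂ)))

/-- The explicit generating tuple of `Ξ(λ,a,N,m)` of Theorem 4.3 (statement 1). -/
def F1 (N a : ℕ) (m q : ℤ) : ℤ → ℂ[X] := fun j =>
  let lamz : ℤ := (N : ℤ) + 1 - a - q
  let nuz : ℤ := (N : ℤ) + 1 - q
  let lam : ℂ := (lamz : ℂ)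
  if 1 ≤ j ∧ j ≤ (N : ℤ) then
    C (Complex.I ^ (-j) * (-1 : ℂ) ^ (nuz - 1)) *
      ∑ r ∈ range (N - j.toNat + 1),
        C ((-1 : ℂ) ^ r * Acoef N m lamz nuz (N - j.toNat) r) *
          gegenCit (lam + (N : ℂ) - 1 - (r : ℂ))
            ((a : ℤ) - m + j + 2 * (1 - (N : ℤ) - nuz + (r : ℤ)))
  else if -(N : ℤ) ≤ j ∧ j ≤ 0 then
    C (Complex.I ^ j) *
      ∑ r ∈ range (N - (-j).toNat + 1),
        C ((-1 : ℂ) ^ r * Bcoef N m lamz nuz (N + (-j).toNat) r) *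
          gegenCit (lam + (N : ℂ) - 1 - (r : ℂ))
            ((a : ℤ) - m + (-j) - 2 * (N : ℤ) + 2 * (r : ℤ))
  else 0

/-- The explicit tuple of statement 16. -/
def F16 (N a : ℕ) (m q : ℤ) : ℤ → ℂ[X] := fun j =>
  let lam : ℂ := (N : ℂ) + 1 - (a : ℂ) - (q : ℂ)
  if 1 ≤ j ∧ j ≤ (N : ℤ) then
    C ((-Complex.I) ^ j.toNat * (((N + j.toNat).factorial : ℂ) / (N.factorial : ℂ)) *
        gratio (lam + ((((a : ℤ) - m - 1) / 2 : ℤ) : ℂ))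
          (((a : ℤ) - m + j - 1) / 2 + q - (N : ℤ) - ((a : ℤ) - m - 1) / 2)) *
      ∑ r ∈ range (N - j.toNat + 1),
        C (Dc N m q j.toNat r) *
          gegenCit (lam + (N : ℂ) - 1 - (r : ℂ))
            ((a : ℤ) - m + j + 2 * (q - 2 * (N : ℤ) + (r : ℤ)))
  else if -(N : ℤ) ≤ j ∧ j ≤ 0 then
    C (Complex.I ^ (-j).toNat * (((N + (-j).toNat).factorial : ℂ) / (N.factorial : ℂ)) *
        gratio (lam + ((((a : ℤ) - m - 1) / 2 : ℤ) : ℂ))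
          (((a : ℤ) - m + (-j) - 1) / 2 - ((a : ℤ) - m - 1) / 2)) *
      ∑ r ∈ range (N - (-j).toNat + 1),
        C (Cm lam a N m (-j).toNat r) *
          gegenCit (lam + (N : ℂ) - 1 - (r : ℂ))
            ((a : ℤ) - m - 2 * (N : ℤ) + (-j) + 2 * (r : ℤ))
  else 0

/-- Integer-indexed coefficients. -/
def gc (p : ℂ[X]) (n : ℤ) : ℂ := if 0 ≤ n then p.coeff n.toNat else 0

lemma gc_add (p q : ℂ[X]) (n : ℤ) : gc (p + q) n = gc p n + gc q n := by
  unfold gc; split_ifs <;> simp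

lemma gc_sub (p q : ℂ[X]) (n : ℤ) : gc (p - q) n = gc p n - gc q n := by
  unfold gc; split_ifs <;> simp

lemma gc_neg (p : ℂ[X]) (n : ℤ) : gc (-p) n = -gc p n := by
  unfold gc; split_ifs <;> simp

lemma gc_C_mul (c : ℂ) (p : ℂ[X]) (n : ℤ) : gc (C c * p) n = c * gc p n := by
  unfold gc; split_ifs <;> simp

lemma gc_X_mul (p : ℂ[X]) (n : ℤ) : gc (X * p) n = gc p (n - 1) := by
  unfold gc
  by_cases h : 0 ≤ n
  · by_cases h1 : n = 0
    · subst h1; simp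
    · have h2 : 0 ≤ n - 1 := by omega
      have h3 : n.toNat = (n - 1).toNat + 1 := by omega
      rw [if_pos h, if_pos h2, h3, coeff_X_mul]
  · rw [if_neg h, if_neg (by omega)]

lemma gc_derivative (p : ℂ[X]) (n : ℤ) :
    gc (derivative p) n = ((n : ℂ) + 1) * gc p (n + 1) := by
  unfold gc
  by_cases h : 0 ≤ n
  · have h3 : (n + 1).toNat = n.toNat + 1 := by omega
    rw [if_pos h, if_pos (by omega), h3, coeff_derivative]
    have : ((n.toNat : ℕ) : ℂ) = (n : ℂ) := by
      have : ((n.toNat : ℤ)) = n := Int.toNat_of_nonneg h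
      exact_mod_cast congrArg (Int.cast : ℤ → ℂ) this
    rw [this]; ring
  · rw [if_neg h]
    by_cases h1 : n = -1
    · subst h1; simp
    · rw [if_neg (by omega)]; simp

lemma gc_ext (p : ℂ[X]) : p = 0 ↔ ∀ n : ℤ, gc p n = 0 := by
  constructor
  · rintro rfl n; simp [gc]
  · intro h; ext n
    have := h n
    simpa [gc] using this

lemma gc_gegenS (μ : ℂ) (l : ℤ) (p : ℂ[X]) (n : ℤ) :
    gc (gegenS μ l p) n = -(((n : ℂ) + 2) * (n + 1) * gc p (n + 2)
      + ((n : ℂ) - l) * (n + l + 2 * μ) * gc p n) := by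
  have : gegenS μ l p = -(derivative (derivative p) + X * (X * derivative (derivative p))
      + C (1 + 2 * μ) * (X * derivative p) - C ((l : ℂ) * ((l : ℂ) + 2 * μ)) * p) := by
    unfold gegenS
    have h : (1 + 2 * C μ : ℂ[X]) = C (1 + 2 * μ) := by
      rw [C_add, C_mul, C_1]; rfl
    rw [h]; ring
  rw [this]
  simp only [gc_add, gc_sub, gc_neg, gc_C_mul, gc_X_mul, gc_derivative]
  have e1 : n - 1 - 1 + 1 + 1 = n := by ring
  have e2 : n - 1 + 1 = n := by ring
  have e3 : n + 1 + 1 = n + 2 := by ring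
  rw [e1, e2, e3]
  push_cast
  ring

/-- First operator on coefficient families. -/
def EA (lam : ℂ) (a N : ℕ) (m : ℤ) (g : ℤ → ℤ → ℂ) (j n : ℤ) : ℂ :=
  ((n : ℂ) + 2) * (n + 1) * g j (n + 2)
    + ((n : ℂ) - (a + m - j)) * (n + (a + m - j) + 2 * (lam + j - 1)) * g j n
    + 2 * (N - j) * (n + 1) * g (j + 1) (n + 1)

/-- Second operator on coefficient families. -/
def EB (lam : ℂ) (a N : ℕ) (m : ℤ) (g : ℤ → ℤ → ℂ) (j n : ℤ) : ℂ :=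
  ((n : ℂ) + 2) * (n + 1) * g j (n + 2)
    + ((n : ℂ) - (a - m + j)) * (n + (a - m + j) + 2 * (lam - j - 1)) * g j n
    - 2 * (N + j) * (n + 1) * g (j - 1) (n + 1)

lemma eqA_plus (lam : ℂ) (a N : ℕ) (m : ℤ) (f : ℤ → ℂ[X]) (j : ℤ) :
    (gegenS (lam + (j : ℂ) - 1) ((a : ℤ) + m - j) (f j)
        - C (2 * ((N : ℂ) - (j : ℂ))) * derivative (f (j + 1)) = 0) ↔
    ∀ n, EA lam a N m (fun j n => gc (f j) n) j n = 0 := by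
  rw [gc_ext]
  refine forall_congr' fun n => ?_
  rw [← neg_eq_zero]
  simp only [gc_sub, gc_gegenS, gc_C_mul, gc_derivative, EA]
  push_cast
  ring_nf

lemma eqA_minus (lam : ℂ) (a N : ℕ) (m : ℤ) (f : ℤ → ℂ[X]) (j : ℤ) :
    (gegenS (lam + (j : ℂ) - 1) ((a : ℤ) - m - j) (f (-j))
        + C (2 * ((N : ℂ) - (j : ℂ))) * derivative (f (-j - 1)) = 0) ↔
    ∀ n, EB lam a N m (fun j n => gc (f j) n) (-j) n = 0 := by
  rw [gc_ext]
  refine forall_congr' fun n => ?_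
  rw [← neg_eq_zero]
  simp only [gc_add, gc_gegenS, gc_C_mul, gc_derivative, EB]
  push_cast
  ring_nf

lemma eqB_plus (lam : ℂ) (a N : ℕ) (m : ℤ) (f : ℤ → ℂ[X]) (j : ℤ) :
    (C (2 * (-(m : ℂ)) * (lam + (a : ℂ) - 1)) * f j
        + C (2 * (j : ℂ)) * (C (lam - 1) * f j + euler (f j))
        + C ((N : ℂ) - (j : ℂ)) * derivative (f (j + 1))
        + C ((N : ℂ) + (j : ℂ)) * derivative (f (j - 1)) = 0) ↔
    ∀ n, EA lam a N m (fun j n => gc (f j) n) j n - EB lam a N m (fun j n => gc (f j) n) j n = 0 := by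
  rw [gc_ext]
  refine forall_congr' fun n => ?_
  have h2 : (2 : ℂ) ≠ 0 := two_ne_zero
  rw [← mul_eq_zero_iff_left h2]
  simp only [gc_add, gc_C_mul, gc_derivative, EA, EB, euler, gc_X_mul, sub_add_cancel]
  push_cast
  ring_nf

lemma eqB_minus (lam : ℂ) (a N : ℕ) (m : ℤ) (f : ℤ → ℂ[X]) (j : ℤ) :
    (C (2 * (m : ℂ) * (lam + (a : ℂ) - 1)) * f (-j)
        + C (2 * (j : ℂ)) * (C (lam - 1) * f (-j) + euler (f (-j)))
        - C ((N : ℂ) + (j : ℂ)) * derivative (f (-j + 1))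
        - C ((N : ℂ) - (j : ℂ)) * derivative (f (-j - 1)) = 0) ↔
    ∀ n, EA lam a N m (fun j n => gc (f j) n) (-j) n
      - EB lam a N m (fun j n => gc (f j) n) (-j) n = 0 := by
  rw [gc_ext]
  refine forall_congr' fun n => ?_
  have h2 : (-2 : ℂ) ≠ 0 := by norm_num
  rw [← mul_eq_zero_iff_left h2]
  simp only [gc_add, gc_sub, gc_C_mul, gc_derivative, EA, EB, euler, gc_X_mul, sub_add_cancel]
  push_cast
  ring_nf

lemma mem_Xi (lam : ℂ) (a N : ℕ) (m : ℤ) (f : ℤ → ℂ[X]) :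
    f ∈ XiSet lam a N m ↔ (∀ j : ℤ, (N : ℤ) < |j| → f j = 0) ∧
    (∀ j : ℤ, |j| ≤ (N : ℤ) → polEven ((a : ℤ) - m + j) (f j)) ∧
    (∀ j : ℤ, |j| ≤ (N : ℤ) → ∀ n, EA lam a N m (fun j n => gc (f j) n) j n = 0 ∧
      EB lam a N m (fun j n => gc (f j) n) j n = 0) := by
  simp only [XiSet, Set.mem_ofPred_eq, eqA_plus, eqA_minus, eqB_plus, eqB_minus]
  refine and_congr_right fun _ => and_congr_right fun _ => ?_
  constructor
  · rintro ⟨h1, h2, h3, h4⟩ j hj n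
    rw [abs_le] at hj
    rcases lt_trichotomy j 0 with h | h | h
    · have e2 := h2 (-j) (by omega) (by omega) n
      have e4 := h4 (-j) (by omega) (by omega) n
      rw [neg_neg] at e2 e4
      rw [e2, sub_zero] at e4
      exact ⟨e4, e2⟩
    · subst h
      have e1 := h1 0 le_rfl (by omega) n
      have e2 := h2 0 le_rfl (by omega) n
      rw [neg_zero] at e2
      exact ⟨e1, e2⟩
    · have e1 := h1 j (by omega) (by omega) n
      have e3 := h3 j (by omega) (by omega) n
      rw [e1, zero_sub, neg_eq_zero] at e3
      exact ⟨e1, e3⟩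
  · intro h
    refine ⟨fun j h0 hN n => (h j (by rw [abs_le]; omega) n).1,
      fun j h0 hN n => (h (-j) (by rw [abs_le]; omega) n).2, fun j h0 hN n => ?_,
      fun j h0 hN n => ?_⟩
    · obtain ⟨x, y⟩ := h j (by rw [abs_le]; omega) n
      rw [x, y, sub_zero]
    · obtain ⟨x, y⟩ := h (-j) (by rw [abs_le]; omega) n
      rw [x, y, sub_zero]

/-- Binomial weights. -/
def wt (N : ℕ) (j : ℤ) : ℂ := if -(N : ℤ) ≤ j then ((2 * N).choose (N + j).toNat : ℂ) else 0

lemma wt_rel (N : ℕ) (j : ℤ) : ((N : ℂ) - j) * wt N j = ((N : ℂ) + j + 1) * wt N (j + 1) := by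
  unfold wt
  by_cases h : -(N : ℤ) ≤ j
  · rw [if_pos h, if_pos (by omega)]
    obtain ⟨k, hk⟩ := Int.eq_ofNat_of_zero_le (show 0 ≤ (N : ℤ) + j by omega)
    have hj : j = k - N := by omega
    subst hj
    have e1 : ((N : ℤ) + (k - N)).toNat = k := by omega
    have e2 : ((N : ℤ) + (k - N + 1)).toNat = k + 1 := by omega
    rw [e1, e2]
    have := Nat.choose_succ_right_eq (2 * N) k
    by_cases hk2 : k ≤ 2 * N
    · have h3 : (((2 * N).choose (k + 1) * (k + 1) : ℕ) : ℂ)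
        = (((2 * N).choose k * (2 * N - k) : ℕ) : ℂ) := by exact_mod_cast this
      push_cast [Nat.cast_sub hk2] at h3
      push_cast
      linear_combination -h3
    · rw [Nat.choose_eq_zero_of_lt (by omega), Nat.choose_eq_zero_of_lt (by omega)]
      simp
  · rw [if_neg h]
    by_cases h1 : j = -N - 1
    · subst h1; push_cast; ring
    · rw [if_neg (by omega)]; ring

lemma wt_ne (N : ℕ) (j : ℤ) (h : |j| ≤ (N : ℤ)) : wt N j ≠ 0 := by
  rw [abs_le] at h
  unfold wt
  rw [if_pos h.1]
  have := Nat.choose_pos (show (N + j).toNat ≤ 2 * N by omega)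
  exact_mod_cast this.ne'

/-- First operator in the weight-space coordinates. -/
def opA (lam : ℂ) (a N : ℕ) (m : ℤ) (d : ℤ → ℤ → ℂ) (i j : ℤ) : ℂ :=
  ((a : ℂ) - m + j - 2 * i + 2) * ((a : ℂ) - m + j - 2 * i + 1) * d (i - 1) j
    - 4 * ((m : ℂ) - j + i) * (lam + a - 1 + j - i) * d i j
    + 2 * ((N : ℂ) + j + 1) * ((a : ℂ) - m + j - 2 * i + 1) * d i (j + 1)

/-- Second operator in the weight-space coordinates. -/
def opB (lam : ℂ) (a N : ℕ) (m : ℤ) (d : ℤ → ℤ → ℂ) (i j : ℤ) : ℂ :=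
  ((a : ℂ) - m + j - 2 * i + 2) * ((a : ℂ) - m + j - 2 * i + 1) * d (i - 1) j
    - 4 * (i : ℂ) * (lam + a - 1 - m - i) * d i j
    - 2 * ((N : ℂ) - j + 1) * ((a : ℂ) - m + j - 2 * i + 1) * d (i - 1) (j - 1)

lemma op_comm (lam : ℂ) (a N : ℕ) (m : ℤ) (d : ℤ → ℤ → ℂ) (i j : ℤ) :
    opA lam a N m (opB lam a N m d) i j = opB lam a N m (opA lam a N m d) i j := by
  unfold opA opB
  simp only [sub_add_cancel, add_sub_cancel_right]
  push_cast
  ring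

/-- Support condition. -/
def Supp (a N : ℕ) (m : ℤ) (d : ℤ → ℤ → ℂ) : Prop :=
  ∀ i j : ℤ, d i j ≠ 0 → 0 ≤ i ∧ -(N : ℤ) ≤ j ∧ j ≤ N ∧ 0 ≤ (a : ℤ) - m + j - 2 * i

lemma opA_of_EA (lam : ℂ) (a N : ℕ) (m : ℤ) (g : ℤ → ℤ → ℂ) (i j : ℤ) :
    opA lam a N m (fun i j => wt N j * g j (a - m + j - 2 * i)) i j
      = wt N j * EA lam a N m g j (a - m + j - 2 * i) := by
  unfold opA EA
  have h := wt_rel N j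
  have e1 : (a : ℤ) - m + j - 2 * (i - 1) = a - m + j - 2 * i + 2 := by ring
  have e2 : (a : ℤ) - m + (j + 1) - 2 * i = a - m + j - 2 * i + 1 := by ring
  simp only [e1, e2]
  push_cast
  linear_combination (-2 * ((a : ℂ) - m + j - 2 * i + 1) * g (j + 1) (a - m + j - 2 * i + 1)) * h

lemma opB_of_EB (lam : ℂ) (a N : ℕ) (m : ℤ) (g : ℤ → ℤ → ℂ) (i j : ℤ) :
    opB lam a N m (fun i j => wt N j * g j (a - m + j - 2 * i)) i j
      = wt N j * EB lam a N m g j (a - m + j - 2 * i) := by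
  unfold opB EB
  have h := wt_rel N (j - 1)
  rw [sub_add_cancel] at h
  push_cast at h
  have e1 : (a : ℤ) - m + j - 2 * (i - 1) = a - m + j - 2 * i + 2 := by ring
  have e2 : (a : ℤ) - m + (j - 1) - 2 * (i - 1) = a - m + j - 2 * i + 1 := by ring
  simp only [e1, e2]
  push_cast
  linear_combination (-2 * ((a : ℂ) - m + j - 2 * i + 1) * g (j - 1) (a - m + j - 2 * i + 1)) * h

/-- A nonzero supported family has an entry of maximal `z`-degree. -/
lemma exists_top (lam : ℂ) (a N : ℕ) (m : ℤ) (d : ℤ → ℤ → ℂ) (hs : Supp a N m d)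
    (hd : ∃ i j, d i j ≠ 0) : ∃ i j, d i j ≠ 0 ∧
      opA lam a N m d i j = - 4 * ((m : ℂ) - j + i) * (lam + a - 1 + j - i) * d i j ∧
      opB lam a N m d i j = - 4 * (i : ℂ) * (lam + a - 1 - m - i) * d i j := by
  classical
  obtain ⟨i0, j0, h0⟩ := hd
  let P : ℕ → Prop := fun k => ∃ i j, d i j ≠ 0 ∧ (a : ℤ) - m + j - 2 * i = a - m + N - k
  have hP : ∃ k, P k := by
    obtain ⟨h1, h2, h3, h4⟩ := hs i0 j0 h0
    exact ⟨(N - j0 + 2 * i0).toNat, i0, j0, h0, by omega⟩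
  obtain ⟨i, j, hij, hk⟩ := Nat.find_spec hP
  have hmax : ∀ i' j', (a : ℤ) - m + j - 2 * i < a - m + j' - 2 * i' → d i' j' = 0 := by
    intro i' j' hlt
    by_contra hne
    obtain ⟨h1, h2, h3, h4⟩ := hs i' j' hne
    have := Nat.find_min' hP (m := (N - j' + 2 * i').toNat) ⟨i', j', hne, by omega⟩
    omega
  refine ⟨i, j, hij, ?_, ?_⟩
  · unfold opA
    rw [hmax (i - 1) j (by omega), hmax i (j + 1) (by omega)]; ring
  · unfold opB
    rw [hmax (i - 1) j (by omega), hmax (i - 1) (j - 1) (by omega)]; ring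

/-- Necessity, with the location of the leading coefficient. -/
lemma sing_top (lam : ℂ) (a N : ℕ) (m : ℤ) (hm : (N : ℤ) < m) (d : ℤ → ℤ → ℂ)
    (hs : Supp a N m d) (hd : ∃ i j, d i j ≠ 0) (hA : ∀ i j, opA lam a N m d i j = 0)
    (hB : ∀ i j, opB lam a N m d i j = 0) :
    ∃ j, d 0 j ≠ 0 ∧ lam = 1 - a - j ∧ -(N : ℤ) ≤ j ∧ j ≤ N ∧ 0 ≤ (a : ℤ) - m + j := by
  obtain ⟨i, j, hij, eA, eB⟩ := exists_top lam a N m d hs hd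
  rw [hA] at eA
  rw [hB] at eB
  obtain ⟨h1, h2, h3, h4⟩ := hs i j hij
  have hα : ((m : ℂ) - j + i) ≠ 0 := by
    have : m - j + i ≠ 0 := by omega
    exact_mod_cast this
  have k1 : lam + a - 1 + j - i = 0 := by
    have := eA.symm
    simpa [hα, hij] using this
  have k2 : (i : ℂ) = 0 := by
    have h := eB.symm
    have h5 : lam + a - 1 - m - i ≠ 0 := by
      intro h6
      have h7 : ((m + j : ℤ) : ℂ) = 0 := by push_cast; linear_combination k1 - h6
      have h8 : m + j = 0 := by exact_mod_cast h7
      omega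
    simpa [h5, hij] using h
  have k3 : i = 0 := by exact_mod_cast k2
  subst k3
  refine ⟨j, hij, ?_, h2, h3, by omega⟩
  linear_combination k1 - k2

/-- Support condition, truncated in the `z`-degree. -/
def Supp2 (a N : ℕ) (m j0 : ℤ) (d : ℤ → ℤ → ℂ) : Prop :=
  ∀ i j : ℤ, ¬(0 ≤ i ∧ -(N : ℤ) ≤ j ∧ j ≤ N ∧ 0 ≤ (a : ℤ) - m + j - 2 * i ∧ j - 2 * i ≤ j0) →
    d i j = 0

lemma Supp2.supp {a N : ℕ} {m j0 : ℤ} {d : ℤ → ℤ → ℂ} (h : Supp2 a N m j0 d) :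
    Supp a N m d := by
  intro i j hij
  by_contra hc
  exact hij (h i j (by tauto))

lemma Supp2.opA {lam : ℂ} {a N : ℕ} {m j0 : ℤ} {d : ℤ → ℤ → ℂ} (h : Supp2 a N m j0 d) :
    Supp2 a N m j0 (opA lam a N m d) := by
  intro i j hij
  unfold _root_.opA
  have t1 : ((a : ℂ) - m + j - 2 * i + 2) * ((a : ℂ) - m + j - 2 * i + 1) * d (i - 1) j = 0 := by
    by_cases e1 : (a : ℤ) - m + j - 2 * i + 2 = 0
    · have : (a : ℂ) - m + j - 2 * i + 2 = 0 := by exact_mod_cast e1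
      rw [this]; ring
    · by_cases e2 : (a : ℤ) - m + j - 2 * i + 1 = 0
      · have : (a : ℂ) - m + j - 2 * i + 1 = 0 := by exact_mod_cast e2
        rw [this]; ring
      · rw [h (i - 1) j (by omega)]; ring
  have t3 : 2 * ((N : ℂ) + j + 1) * ((a : ℂ) - m + j - 2 * i + 1) * d i (j + 1) = 0 := by
    by_cases e1 : (N : ℤ) + j + 1 = 0
    · have : (N : ℂ) + j + 1 = 0 := by exact_mod_cast e1
      rw [this]; ring
    · by_cases e2 : (a : ℤ) - m + j - 2 * i + 1 = 0
      · have : (a : ℂ) - m + j - 2 * i + 1 = 0 := by exact_mod_cast e2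
        rw [this]; ring
      · rw [h i (j + 1) (by omega)]; ring
  rw [t1, t3, h i j hij]; ring

lemma Supp2.opB {lam : ℂ} {a N : ℕ} {m j0 : ℤ} {d : ℤ → ℤ → ℂ} (h : Supp2 a N m j0 d) :
    Supp2 a N m j0 (opB lam a N m d) := by
  intro i j hij
  unfold _root_.opB
  have t1 : ((a : ℂ) - m + j - 2 * i + 2) * ((a : ℂ) - m + j - 2 * i + 1) * d (i - 1) j = 0 := by
    by_cases e1 : (a : ℤ) - m + j - 2 * i + 2 = 0
    · have : (a : ℂ) - m + j - 2 * i + 2 = 0 := by exact_mod_cast e1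
      rw [this]; ring
    · by_cases e2 : (a : ℤ) - m + j - 2 * i + 1 = 0
      · have : (a : ℂ) - m + j - 2 * i + 1 = 0 := by exact_mod_cast e2
        rw [this]; ring
      · rw [h (i - 1) j (by omega)]; ring
  have t3 : 2 * ((N : ℂ) - j + 1) * ((a : ℂ) - m + j - 2 * i + 1) * d (i - 1) (j - 1) = 0 := by
    by_cases e1 : (N : ℤ) - j + 1 = 0
    · have : (N : ℂ) - j + 1 = 0 := by exact_mod_cast e1
      rw [this]; ring
    · by_cases e2 : (a : ℤ) - m + j - 2 * i + 1 = 0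
      · have : (a : ℂ) - m + j - 2 * i + 1 = 0 := by exact_mod_cast e2
        rw [this]; ring
      · rw [h (i - 1) (j - 1) (by omega)]; ring
  rw [t1, t3, h i j hij]; ring

lemma int_add_I (x y : ℤ) (h : (x : ℂ) + Complex.I * y = 0) : x = 0 ∧ y = 0 := by
  have h1 := congrArg Complex.re h
  have h2 := congrArg Complex.im h
  simp at h1 h2
  exact ⟨h1, h2⟩

/-- The kernel of `opA + I * opB` is detected by the coefficient at `(0, j0)`. -/
lemma ker_top (a N : ℕ) (m j0 : ℤ) (hm : (N : ℤ) < m) (h1 : -(N : ℤ) ≤ j0)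
    (d : ℤ → ℤ → ℂ)
    (hs : Supp a N m d) (hd : ∃ i j, d i j ≠ 0)
    (hT : ∀ i j, opA (1 - a - j0) a N m d i j + Complex.I * opB (1 - a - j0) a N m d i j = 0) :
    d 0 j0 ≠ 0 := by
  obtain ⟨i, j, hij, eA, eB⟩ := exists_top (1 - a - j0) a N m d hs hd
  obtain ⟨k1, k2, k3, k4⟩ := hs i j hij
  have h := hT i j
  rw [eA, eB] at h
  have h' : (((m - j + i) * (-j0 + j - i) : ℤ) : ℂ)
      + Complex.I * ((i * (-j0 - m - i) : ℤ) : ℂ) = 0 := by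
    apply mul_left_cancel₀ (mul_ne_zero (show (-4 : ℂ) ≠ 0 by norm_num) hij)
    push_cast
    linear_combination h
  obtain ⟨x, y⟩ := int_add_I _ _ h'
  have hi : i = 0 := by
    rcases mul_eq_zero.1 y with y | y
    · exact y
    · omega
  have hj : j = j0 := by
    rcases mul_eq_zero.1 x with x | x <;> omega
  rw [hi, hj] at hij
  exact hij

/-- Existence of a solution. -/
lemma exists_sing (a N : ℕ) (m j0 : ℤ) (hm : (N : ℤ) < m) (h1 : -(N : ℤ) ≤ j0) (h2 : j0 ≤ N)
    (h3 : 0 ≤ (a : ℤ) - m + j0) :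
    ∃ d, Supp a N m d ∧ d 0 j0 ≠ 0 ∧ (∀ i j, opA (1 - a - j0) a N m d i j = 0) ∧
      (∀ i j, opB (1 - a - j0) a N m d i j = 0) := by
  classical
  set lam : ℂ := 1 - a - j0 with hlam
  let S : Finset (ℤ × ℤ) := ((Finset.Icc (0 : ℤ) (a + N)) ×ˢ (Finset.Icc (-(N : ℤ)) N)).filter
    (fun s => 0 ≤ (a : ℤ) - m + s.2 - 2 * s.1 ∧ s.2 - 2 * s.1 ≤ j0)
  have hS : ∀ i j : ℤ, (i, j) ∈ S ↔
      (0 ≤ i ∧ -(N : ℤ) ≤ j ∧ j ≤ N ∧ 0 ≤ (a : ℤ) - m + j - 2 * i ∧ j - 2 * i ≤ j0) := by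
    intro i j
    simp only [S, Finset.mem_filter, Finset.mem_product, Finset.mem_Icc]
    omega
  let ex : (S → ℂ) → ℤ → ℤ → ℂ := fun v i j => if h : (i, j) ∈ S then v ⟨(i, j), h⟩ else 0
  have hex : ∀ v, Supp2 a N m j0 (ex v) := by
    intro v i j hij
    simp only [ex]
    rw [dif_neg]
    rwa [hS]
  let T : (S → ℂ) →ₗ[ℂ] (S → ℂ) :=
    { toFun := fun v s => opA lam a N m (ex v) s.1.1 s.1.2
        + Complex.I * opB lam a N m (ex v) s.1.1 s.1.2
      map_add' := by
        intro v w
        have e : ∀ i j, ex (v + w) i j = ex v i j + ex w i j := by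
          intro i j; simp only [ex]; split_ifs <;> simp
        funext s
        simp only [opA, opB, e, Pi.add_apply]
        ring
      map_smul' := by
        intro c v
        have e : ∀ i j, ex (c • v) i j = c * ex v i j := by
          intro i j; simp only [ex]; split_ifs <;> simp
        funext s
        simp only [opA, opB, e, Pi.smul_apply, smul_eq_mul, RingHom.id_apply]
        ring }
  -- both operators vanish at the distinguished spot
  have hA0 : ∀ d, Supp2 a N m j0 d → opA lam a N m d 0 j0 = 0 := by
    intro d hd
    unfold opA
    rw [hd (0 - 1) j0 (by omega), hd 0 (j0 + 1) (by omega), hlam]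
    push_cast; ring
  have hB0 : ∀ d, Supp2 a N m j0 d → opB lam a N m d 0 j0 = 0 := by
    intro d hd
    unfold opB
    rw [hd (0 - 1) j0 (by omega), hd (0 - 1) (j0 - 1) (by omega)]
    push_cast; ring
  have htop : ((0 : ℤ), j0) ∈ S := by rw [hS]; omega
  have hns : ¬ Function.Surjective T := by
    intro hsur
    obtain ⟨v, hv⟩ := hsur (Pi.single ⟨(0, j0), htop⟩ 1)
    have h := congrFun hv ⟨(0, j0), htop⟩
    simp only [Pi.single_eq_same] at h
    have h' : opA lam a N m (ex v) 0 j0 + Complex.I * opB lam a N m (ex v) 0 j0 = 1 := h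
    rw [hA0 _ (hex v), hB0 _ (hex v)] at h'
    simp at h'
  have hni : ¬ Function.Injective T := fun h => hns (LinearMap.injective_iff_surjective.1 h)
  rw [injective_iff_map_eq_zero] at hni
  push Not at hni
  obtain ⟨v, hv, hv0⟩ := hni
  set d := ex v with hd
  have hd2 : Supp2 a N m j0 d := hex v
  have hT : ∀ i j, opA lam a N m d i j + Complex.I * opB lam a N m d i j = 0 := by
    intro i j
    by_cases h : (i, j) ∈ S
    · exact congrFun hv ⟨(i, j), h⟩
    · rw [hS] at h
      rw [hd2.opA i j h, hd2.opB i j h]; simp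
  have hdne : ∃ i j, d i j ≠ 0 := by
    by_contra hc
    push Not at hc
    apply hv0
    funext s
    have := hc s.1.1 s.1.2
    have hs : (s.1.1, s.1.2) ∈ S := s.2
    simp only [hd, ex] at this
    rw [dif_pos hs] at this
    exact this
  have hA : ∀ i j, opA lam a N m d i j = 0 := by
    by_contra hc
    push Not at hc
    refine ker_top a N m j0 hm h1 (opA lam a N m d) hd2.opA.supp hc ?_ (hA0 d hd2)
    intro i j
    rw [← hlam, ← op_comm]
    have e : ∀ i j, opB lam a N m d i j = Complex.I * opA lam a N m d i j := by
      intro i j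
      linear_combination (-Complex.I) * hT i j + opB lam a N m d i j * Complex.I_sq
    have e2 : opB lam a N m d = fun i j => Complex.I * opA lam a N m d i j := by
      funext i j; exact e i j
    have e3 : opA lam a N m (opB lam a N m d) i j
        = Complex.I * opA lam a N m (opA lam a N m d) i j := by
      rw [e2]
      generalize opA lam a N m d = x
      unfold opA; ring
    rw [e3]
    linear_combination opA lam a N m (opA lam a N m d) i j * Complex.I_sq
  refine ⟨d, hd2.supp, ker_top a N m j0 hm h1 d hd2.supp hdne hT, hA, ?_⟩
  intro i j
  have := hT i j
  rw [hA, zero_add] at this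
  simpa using this

/-- From polynomial tuples to coefficient families. -/
def toD (a N : ℕ) (m : ℤ) (f : ℤ → ℂ[X]) (i j : ℤ) : ℂ :=
  wt N j * gc (f j) (a - m + j - 2 * i)

lemma toD_spec (lam : ℂ) (a N : ℕ) (m : ℤ) (f : ℤ → ℂ[X]) (hf : f ∈ XiSet lam a N m) :
    Supp a N m (toD a N m f) ∧ (∀ i j, opA lam a N m (toD a N m f) i j = 0) ∧
      (∀ i j, opB lam a N m (toD a N m f) i j = 0) ∧
      ((∀ i j, toD a N m f i j = 0) → f = 0) := by
  rw [mem_Xi] at hf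
  obtain ⟨h0, hp, hE⟩ := hf
  have hw : ∀ j, ¬ |j| ≤ (N : ℤ) → wt N j = 0 := by
    intro j hj
    unfold wt
    split_ifs with h
    · rw [abs_le] at hj
      rw [Nat.choose_eq_zero_of_lt (by omega)]; simp
    · rfl
  refine ⟨?_, ?_, ?_, ?_⟩
  · intro i j hij
    have hj : |j| ≤ (N : ℤ) := by
      by_contra hc
      exact hij (by simp [toD, hw j hc])
    have hg : gc (f j) (a - m + j - 2 * i) ≠ 0 := right_ne_zero_of_mul hij
    unfold gc at hg
    split_ifs at hg with hn
    · have := hp j hj _ hg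
      rw [abs_le] at hj
      omega
    · exact absurd rfl hg
  · intro i j
    have := opA_of_EA lam a N m (fun j n => gc (f j) n) i j
    refine this.trans ?_
    by_cases hj : |j| ≤ (N : ℤ)
    · rw [(hE j hj _).1, mul_zero]
    · rw [hw j hj, zero_mul]
  · intro i j
    have := opB_of_EB lam a N m (fun j n => gc (f j) n) i j
    refine this.trans ?_
    by_cases hj : |j| ≤ (N : ℤ)
    · rw [(hE j hj _).2, mul_zero]
    · rw [hw j hj, zero_mul]
  · intro hz
    funext j
    by_cases hj : |j| ≤ (N : ℤ)
    · ext n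
      by_contra hc
      obtain ⟨k1, k, hk⟩ := hp j hj n hc
      have h := hz k j
      unfold toD at h
      have e : (a : ℤ) - m + j - 2 * k = n := by omega
      rw [e] at h
      rcases mul_eq_zero.1 h with h | h
      · exact wt_ne N j hj h
      · exact hc (by simpa [gc] using h)
    · exact h0 j (by omega)

/-- From coefficient families to polynomial tuples. -/
lemma exists_Xi (lam : ℂ) (a N : ℕ) (m : ℤ) (d : ℤ → ℤ → ℂ) (hs : Supp a N m d)
    (hA : ∀ i j, opA lam a N m d i j = 0) (hB : ∀ i j, opB lam a N m d i j = 0)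
    (hd : ∃ i j, d i j ≠ 0) : ∃ f ∈ XiSet lam a N m, f ≠ 0 := by
  let g : ℤ → ℤ → ℂ := fun j n =>
    if (2 : ℤ) ∣ (a - m + j - n) then d ((a - m + j - n) / 2) j / wt N j else 0
  have hg : ∀ j n, g j n ≠ 0 → (2 : ℤ) ∣ (a - m + j - n) ∧ 0 ≤ n ∧ n ≤ (a : ℤ) - m + j ∧
      |j| ≤ (N : ℤ) := by
    intro j n h
    simp only [g] at h
    split_ifs at h with h2
    · have h3 : d ((a - m + j - n) / 2) j ≠ 0 := by
        intro h4; exact h (by rw [h4, zero_div])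
      have := hs _ _ h3
      rw [abs_le]
      omega
    · exact absurd rfl h
  let f : ℤ → ℂ[X] := fun j =>
    ∑ n ∈ Finset.range (((a : ℤ) - m + j).toNat + 1), monomial n (g j (n : ℤ))
  have hfc : ∀ j (n : ℕ), (f j).coeff n = g j n := by
    intro j n
    simp only [f, finsetSum_coeff, coeff_monomial]
    rw [Finset.sum_ite_eq']
    split_ifs with h
    · rfl
    · by_contra hc
      have := hg j n (Ne.symm hc)
      apply h
      rw [Finset.mem_range]; omega
  have hfg : ∀ j n, gc (f j) n = g j n := by
    intro j n
    unfold gc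
    split_ifs with h
    · rw [hfc, Int.toNat_of_nonneg h]
    · by_contra hc
      exact h (hg j n (Ne.symm hc)).2.1
  have hfun : (fun j n => gc (f j) n) = g := by funext j n; exact hfg j n
  have hdg : (fun i j => wt N j * g j (a - m + j - 2 * i)) = d := by
    funext i j
    have e : (a : ℤ) - m + j - (a - m + j - 2 * i) = 2 * i := by ring
    simp only [g, e]
    rw [if_pos (dvd_mul_right _ _), Int.mul_ediv_cancel_left _ two_ne_zero]
    by_cases hj : |j| ≤ (N : ℤ)
    · exact mul_div_cancel₀ _ (wt_ne N j hj)
    · have : d i j = 0 := by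
        by_contra hc
        have := hs i j hc
        rw [abs_le] at hj
        omega
      rw [this]; simp
  refine ⟨f, ?_, ?_⟩
  · rw [mem_Xi, hfun]
    refine ⟨?_, ?_, ?_⟩
    · intro j hj
      ext n
      rw [hfc, coeff_zero]
      by_contra hc
      have := (hg j n hc).2.2.2
      omega
    · intro j hj n hn
      rw [hfc] at hn
      have := hg j n hn
      exact ⟨this.2.2.1, this.1⟩
    · intro j hj n
      by_cases hp : (2 : ℤ) ∣ (a - m + j - n)
      · obtain ⟨k, hk⟩ := hp
        have en : n = a - m + j - 2 * k := by omega
        have kA := opA_of_EA lam a N m g k j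
        have kB := opB_of_EB lam a N m g k j
        rw [hdg, ← en] at kA kB
        rw [hA] at kA
        rw [hB] at kB
        have hw := wt_ne N j hj
        exact ⟨(mul_eq_zero.1 kA.symm).resolve_left hw, (mul_eq_zero.1 kB.symm).resolve_left hw⟩
      · have z : ∀ j' n', ¬ (2 : ℤ) ∣ (a - m + j' - n') → g j' n' = 0 := by
          intro j' n' h
          by_contra hc
          exact h (hg j' n' hc).1
        unfold EA EB
        rw [z j (n + 2) (by omega), z j n hp, z (j + 1) (n + 1) (by omega),
          z (j - 1) (n + 1) (by omega)]
        constructor <;> ring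
  · intro hf0
    obtain ⟨i, j, hij⟩ := hd
    apply hij
    rw [← hdg]
    simp only
    rw [← hfg, hf0]
    simp [gc]

/-- The solution set is closed under linear combinations. -/
lemma Xi_comb (lam : ℂ) (a N : ℕ) (m : ℤ) (f g : ℤ → ℂ[X]) (hf : f ∈ XiSet lam a N m)
    (hg : g ∈ XiSet lam a N m) (c : ℂ) : g - c • f ∈ XiSet lam a N m := by
  rw [mem_Xi] at hf hg ⊢
  obtain ⟨f1, f2, f3⟩ := hf
  obtain ⟨g1, g2, g3⟩ := hg
  refine ⟨?_, ?_, ?_⟩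
  · intro j hj
    simp [f1 j hj, g1 j hj]
  · intro j hj n hn
    by_cases hz : (g j).coeff n = 0
    · apply f2 j hj n
      intro h
      apply hn
      simp [hz, h]
    · exact g2 j hj n hz
  · intro j hj n
    obtain ⟨x1, x2⟩ := f3 j hj n
    obtain ⟨y1, y2⟩ := g3 j hj n
    have e : ∀ j n, gc ((g - c • f) j) n = gc (g j) n - c * gc (f j) n := by
      intro j n
      rw [Pi.sub_apply, Pi.smul_apply, smul_eq_C_mul, gc_sub, gc_C_mul]
    unfold EA at x1 y1 ⊢
    unfold EB at x2 y2 ⊢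
    simp only [e]
    constructor
    · linear_combination y1 - c * x1
    · linear_combination y2 - c * x2

lemma Xi_top (lam : ℂ) (a N : ℕ) (m : ℤ) (hm : (N : ℤ) < m) (f : ℤ → ℂ[X])
    (hf : f ∈ XiSet lam a N m) (hne : f ≠ 0) :
    ∃ j, toD a N m f 0 j ≠ 0 ∧ lam = 1 - a - j ∧ -(N : ℤ) ≤ j ∧ j ≤ N ∧ 0 ≤ (a : ℤ) - m + j := by
  obtain ⟨h1, h2, h3, h4⟩ := toD_spec lam a N m f hf
  refine sing_top lam a N m hm _ h1 ?_ h2 h3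
  by_contra hc
  push Not at hc
  exact hne (h4 hc)

lemma zero_mem_Xi (lam : ℂ) (a N : ℕ) (m : ℤ) : (0 : ℤ → ℂ[X]) ∈ XiSet lam a N m := by
  rw [mem_Xi]
  refine ⟨fun _ _ => rfl, fun j _ n hn => absurd (by simp) hn, fun j _ n => ?_⟩
  simp [EA, EB, gc]

lemma Xi_span (lam : ℂ) (a N : ℕ) (m : ℤ) (hm : (N : ℤ) < m) (f g : ℤ → ℂ[X])
    (hf : f ∈ XiSet lam a N m) (hne : f ≠ 0) (hg : g ∈ XiSet lam a N m) :
    ∃ c : ℂ, g = c • f := by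
  obtain ⟨j, h1, h2, -⟩ := Xi_top lam a N m hm f hf hne
  refine ⟨toD a N m g 0 j / toD a N m f 0 j, ?_⟩
  set c := toD a N m g 0 j / toD a N m f 0 j with hc
  by_contra hn
  obtain ⟨j', k1, k2, -⟩ := Xi_top lam a N m hm _ (Xi_comb lam a N m f g hf hg c)
    (sub_ne_zero.2 hn)
  have : (j' : ℂ) = j := by linear_combination k2 - h2
  have : j' = j := by exact_mod_cast this
  subst this
  apply k1
  have e : toD a N m (g - c • f) 0 j' = toD a N m g 0 j' - c * toD a N m f 0 j' := by
    unfold toD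
    rw [Pi.sub_apply, Pi.smul_apply, smul_eq_C_mul, gc_sub, gc_C_mul]
    ring
  rw [e, hc, div_mul_cancel₀ _ h1, sub_self]

/-- For `m > N` and `a ≥ m - N`, the conditions (i) `Ξ(λ,a,N,m) ≠ {0}`,
(ii) `dim_ℂ Ξ(λ,a,N,m) = 1` (i.e. `Ξ` is spanned by a single nonzero element),
(iii) `λ ∈ Λ(N,a,m)` are equivalent. -/
theorem stmt0 (lam : ℂ) (a N : ℕ) (m : ℤ) (hm : (N : ℤ) < m) (ha : m - (N : ℤ) ≤ (a : ℤ)) :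
    (XiSet lam a N m ≠ {0} ↔
      ∃ f ∈ XiSet lam a N m, f ≠ 0 ∧ ∀ g ∈ XiSet lam a N m, ∃ c : ℂ, g = c • f) ∧
    ((∃ f ∈ XiSet lam a N m, f ≠ 0 ∧ ∀ g ∈ XiSet lam a N m, ∃ c : ℂ, g = c • f) ↔
      lam ∈ LambdaSet N a m) := by
  have h31 : lam ∈ LambdaSet N a m → ∃ f ∈ XiSet lam a N m, f ≠ 0 := by
    rintro ⟨q, hq1, hq2, rfl⟩
    have hq3 := (max_le_iff.1 hq1)
    obtain ⟨d, hs, hd, hA, hB⟩ := exists_sing a N m (q - N) hm (by omega) (by omega) (by omega)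
    have e : (1 - (a : ℂ) - ((q - N : ℤ) : ℂ)) = (N : ℂ) + 1 - a - q := by push_cast; ring
    rw [e] at hA hB
    exact exists_Xi _ a N m d hs hA hB ⟨_, _, hd⟩
  have h13 : (∃ f ∈ XiSet lam a N m, f ≠ 0) → lam ∈ LambdaSet N a m := by
    rintro ⟨f, hf, hne⟩
    obtain ⟨j, -, h2, h3, h4, h5⟩ := Xi_top lam a N m hm f hf hne
    refine ⟨N + j, by omega, by omega, ?_⟩
    rw [h2]; push_cast; ring
  have h12 : (∃ f ∈ XiSet lam a N m, f ≠ 0) →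
      ∃ f ∈ XiSet lam a N m, f ≠ 0 ∧ ∀ g ∈ XiSet lam a N m, ∃ c : ℂ, g = c • f := by
    rintro ⟨f, hf, hne⟩
    exact ⟨f, hf, hne, fun g hg => Xi_span lam a N m hm f g hf hne hg⟩
  refine ⟨⟨fun h => h12 ?_, ?_⟩, fun ⟨f, hf, hne, _⟩ => h13 ⟨f, hf, hne⟩, fun h => h12 (h31 h)⟩
  · by_contra hc
    push Not at hc
    apply h
    ext f
    constructor
    · exact fun hf => hc f hf
    · rintro rfl
      exact zero_mem_Xi lam a N m
  · rintro ⟨f, hf, hne, _⟩ h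
    rw [h] at hf
    exact hne hf
end
end

section
/- Let a, N ∈ ℕ and m ∈ ℤ with m > N and a ≥ m−N, let q ∈ ℤ with max(0, N-a+m) ≤ q ≤ 2N, and set λ := N+1-a-q ∈ Λ(N,a,m) and ν := λ+a = N+1-q. Then Ξ(λ,a,N,m) is one-dimensional, spanned by the tuple (f_{-N},…,f_N) given by f_j(t) = i^{-j} (-1)^{ν-1} Σ_{r=0}^{N-j} (-1)^r A(N-j, r) C̃_{a-m+j+2(1-N-ν+r)}^{λ+N-1-r}(it) for 1 ≤ j ≤ N, and f_{-j}(t) = i^{-j} Σ_{r=0}^{N-j} (-1)^r B(N+j, r) C̃_{a-m+j-2N+2r}^{λ+N-1-r}(it) for 0 ≤ j ≤ N. -/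
noncomputable section

open Polynomial Finset

/-! ### Combinatorial part -/

/-- `1/x!`, zero for negative `x`. -/
def rf (x : ℤ) : ℂ := if x < 0 then 0 else ((x.toNat.factorial : ℂ))⁻¹

lemma rf_neg {x : ℤ} (h : x < 0) : rf x = 0 := by simp [rf, h]

lemma rf_natCast (n : ℕ) : rf (n : ℤ) = ((n.factorial : ℂ))⁻¹ := by simp [rf]

lemma rf_ne {x : ℤ} (h : 0 ≤ x) : rf x ≠ 0 := by
  obtain ⟨n, rfl⟩ := Int.eq_ofNat_of_zero_le h
  rw [rf_natCast]
  exact inv_ne_zero (by exact_mod_cast n.factorial_ne_zero)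

lemma rf_mul (x : ℤ) : (x : ℂ) * rf x = rf (x - 1) := by
  rcases lt_trichotomy x 0 with h | h | h
  · rw [rf_neg h, rf_neg (by omega)]; simp
  · subst h; rw [rf_neg (x := 0 - 1) (by omega)]; simp
  · obtain ⟨n, rfl⟩ : ∃ n : ℕ, x = ((n + 1 : ℕ) : ℤ) := ⟨(x - 1).toNat, by omega⟩
    have : (((n + 1 : ℕ) : ℤ) - 1) = (n : ℤ) := by push_cast; ring
    rw [this, rf_natCast, rf_natCast, Nat.factorial_succ]
    have h1 : (n : ℂ) + 1 ≠ 0 := by exact_mod_cast Nat.succ_ne_zero n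
    have h2 : (n.factorial : ℂ) ≠ 0 := by exact_mod_cast n.factorial_ne_zero
    push_cast
    field_simp

/-- A substitute for `Γ(z)` at integers `z ≤ 0`. -/
def gg (z : ℤ) : ℂ := (-1 : ℂ) ^ z * rf (-z)

lemma gg_ne {z : ℤ} (h : z ≤ 0) : gg z ≠ 0 :=
  mul_ne_zero (zpow_ne_zero _ (by norm_num)) (rf_ne (by omega))

lemma gg_mul (z : ℤ) : (z : ℂ) * gg z = gg (z + 1) := by
  have h := rf_mul (-z)
  unfold gg
  rw [zpow_add₀ (by norm_num), show -(z + 1) = -z - 1 by ring, ← h]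
  push_cast
  simp
  ring

lemma gg_prod (z : ℤ) (L : ℕ) : (∏ i ∈ range L, ((z : ℂ) + (i : ℂ))) * gg z = gg (z + L) := by
  induction L with
  | zero => simp
  | succ L ih =>
    rw [prod_range_succ, mul_right_comm, ih, mul_comm]
    have := gg_mul (z + L)
    push_cast at this ⊢
    rw [this, add_assoc]

lemma gq_eq {z₁ z₂ : ℤ} (h1 : z₁ ≤ 0) (h2 : z₂ ≤ 0) : gq z₁ z₂ = gg z₁ / gg z₂ := by
  unfold gq gratio
  have n1 := gg_ne h1
  have n2 := gg_ne h2
  split_ifs with h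
  · have := gg_prod z₂ (z₁ - z₂).toNat
    rw [show z₂ + ((z₁ - z₂).toNat : ℤ) = z₁ by omega] at this
    rw [← this]
    field_simp
  · have := gg_prod z₁ (-(z₁ - z₂)).toNat
    rw [show z₁ + ((-(z₁ - z₂)).toNat : ℤ) = z₂ by omega] at this
    have e : ∀ i : ℕ, (z₂ : ℂ) + ((z₁ - z₂ : ℤ) : ℂ) + (i : ℂ) = (z₁ : ℂ) + i := by
      intro i; push_cast; ring
    simp only [e]
    rw [← this] at n2 ⊢
    have n3 := left_ne_zero_of_mul n2
    field_simp

lemma fall_prod (x r : ℕ) : (∏ i ∈ range r, ((x : ℂ) - (i : ℂ))) = (x.factorial : ℂ) * rf ((x : ℤ) - r) := by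
  induction r with
  | zero =>
    have h2 : (x.factorial : ℂ) ≠ 0 := by exact_mod_cast x.factorial_ne_zero
    simp [rf_natCast, h2]
  | succ r ih =>
    rw [prod_range_succ, ih]
    have := rf_mul ((x : ℤ) - r)
    rw [show (x : ℤ) - (r + 1 : ℕ) = (x : ℤ) - r - 1 by push_cast; ring, ← this]
    push_cast; ring

lemma fall_prodZ (x : ℤ) (hx : 0 ≤ x) (r : ℕ) :
    (∏ i ∈ range r, ((x : ℂ) - (i : ℂ))) = (x.toNat.factorial : ℂ) * rf (x - r) := by
  obtain ⟨n, rfl⟩ := Int.eq_ofNat_of_zero_le hx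
  simpa using fall_prod n r

/-- The basic sum. -/
def HH (w : ℕ → ℂ) (M : ℕ) (y : ℤ) : ℂ :=
  ∑ r ∈ range (M + 1), (M.choose r : ℂ) * w r * rf (y + r)

lemma HH_rec (w : ℕ → ℂ) (M : ℕ) (y : ℤ) :
    HH w M (y - 1) + (M : ℂ) * HH w (M - 1) y = ((y : ℂ) + M) * HH w M y := by
  have key : ∀ r : ℕ, rf (y - 1 + r) = ((y : ℂ) + r) * rf (y + r) := by
    intro r
    have := rf_mul (y + r)
    push_cast at this
    rw [this]; congr 1; ring
  cases M with
  | zero =>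
    have := key 0
    simp only [Nat.cast_zero, add_zero] at this
    simp [HH, this]; ring
  | succ M =>
    have e2 : HH w M y = ∑ r ∈ range (M + 1 + 1), (M.choose r : ℂ) * w r * rf (y + r) := by
      rw [sum_range_succ]; simp [HH]
    rw [show M + 1 - 1 = M from rfl, e2]
    unfold HH
    rw [mul_sum, mul_sum, ← sum_add_distrib]
    refine sum_congr rfl fun r hr => ?_
    have hr' : r ≤ M + 1 := by simpa [Nat.lt_succ_iff] using hr
    rw [key]
    have h := Nat.add_one_mul_choose_eq M r
    have h3 : ((M : ℂ) + 1) * (M.choose r : ℂ) = ((M + 1).choose r : ℂ) * ((M : ℂ) + 1 - r) := by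
      have h4 := Nat.choose_mul_succ_eq M r
      have h5 : ((M.choose r * (M + 1) : ℕ) : ℂ) = (((M+1).choose r * (M + 1 - r) : ℕ) : ℂ) := by
        rw [h4]
      rw [Nat.cast_mul, Nat.cast_mul, Nat.cast_sub hr'] at h5
      push_cast at h5
      linear_combination h5
    push_cast
    linear_combination (w r * rf (y + r)) * h3

lemma HH_top (w : ℕ → ℂ) (M : ℕ) : HH w M (-(M : ℤ)) = w M := by
  unfold HH
  rw [sum_range_succ, sum_eq_zero]
  · simp [rf]
  · intro r hr
    rw [rf_neg (by simp at hr; omega)]; simp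

/-- weights -/
def ww (N : ℕ) (m Q : ℤ) (r : ℕ) : ℂ :=
  ((2 * N - r).factorial : ℂ) * rf ((N : ℤ) + m - r) * rf (Q - r)

/-- The top coefficients. -/
def E0 (N : ℕ) (m q : ℤ) (i : ℤ) : ℂ :=
  gg (N - q - m) * ((-2 : ℂ) ^ i * (((N : ℤ) - i).toNat.factorial : ℂ) * rf (m - i) * rf (q - N - i))

/-- The solution; here `ν = N + 1 - q`. -/
def EN (N : ℕ) (m q : ℤ) : ℕ → ℤ → ℂ
  | 0 => E0 N m q
  | k + 1 => fun j => (EN N m q k j - 2 * ((N : ℂ) + j) * EN N m q k (j - 1)) /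
      (4 * ((k : ℂ) + 1) * ((N : ℂ) - q - m - 1 - k))

/-- extended by zero -/
def EZ (N : ℕ) (m q : ℤ) (j k : ℤ) : ℂ := if k < 0 then 0 else EN N m q k.toNat j

lemma EZ_nat (N : ℕ) (m q : ℤ) (j : ℤ) (k : ℕ) : EZ N m q j k = EN N m q k j := by simp [EZ]

lemma EZ_neg (N : ℕ) (m q : ℤ) (j : ℤ) {k : ℤ} (h : k < 0) : EZ N m q j k = 0 := by simp [EZ, h]

lemma den_ne (N : ℕ) (m q : ℤ) (hm : (N : ℤ) < m) (hq : 0 ≤ q) (k : ℕ) :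
    (N : ℂ) - q - m - 1 - k ≠ 0 := by
  have : (N : ℤ) - q - m - 1 - k ≠ 0 := by omega
  exact_mod_cast this

lemma EN_succ (N : ℕ) (m q : ℤ) (hm : (N : ℤ) < m) (hq : 0 ≤ q) (k : ℕ) (j : ℤ) :
    EN N m q k j - 4 * ((k : ℂ) + 1) * ((N : ℂ) - q - m - 1 - k) * EN N m q (k + 1) j
      - 2 * ((N : ℂ) + j) * EN N m q k (j - 1) = 0 := by
  have h1 := den_ne N m q hm hq k
  have h2 : (k : ℂ) + 1 ≠ 0 := by exact_mod_cast Nat.succ_ne_zero k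
  simp only [EN]
  field_simp
  ring

/-- equation A' -/
lemma EZ_A' (N : ℕ) (m q : ℤ) (hm : (N : ℤ) < m) (hq : 0 ≤ q) (k : ℤ) (j : ℤ) :
    EZ N m q j (k - 1) - 4 * (k : ℂ) * ((N : ℂ) - q - m - k) * EZ N m q j k
      - 2 * ((N : ℂ) + j) * EZ N m q (j - 1) (k - 1) = 0 := by
  rcases lt_trichotomy k 0 with h | h | h
  · simp [EZ_neg N m q _ h, EZ_neg N m q _ (show k - 1 < 0 by omega)]
  · subst h
    simp [EZ_neg N m q _ (show (-1 : ℤ) < 0 by omega)]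
  · obtain ⟨n, rfl⟩ : ∃ n : ℕ, k = ((n + 1 : ℕ) : ℤ) := ⟨(k - 1).toNat, by omega⟩
    have : (((n + 1 : ℕ) : ℤ) - 1) = (n : ℤ) := by push_cast; ring
    rw [this, EZ_nat, EZ_nat, EZ_nat]
    have := EN_succ N m q hm hq n j
    push_cast
    linear_combination this

lemma E0_A (N : ℕ) (m q : ℤ) (hq2 : q ≤ 2 * N) (j : ℤ) (hj : j ≤ N) :
    4 * ((j : ℂ) - m) * ((N : ℂ) - q + j) * E0 N m q j + 2 * ((N : ℂ) - j) * E0 N m q (j + 1) = 0 := by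
  have h1 := rf_mul (m - j)
  have h2 := rf_mul (q - N - j)
  unfold E0
  rw [show m - (j + 1) = m - j - 1 by ring, show q - N - (j + 1) = q - N - j - 1 by ring, ← h1, ← h2]
  rcases eq_or_lt_of_le hj with h | h
  · subst h
    rw [rf_neg (x := q - N - N - 1) (by omega)] at h2
    push_cast at h2 ⊢
    linear_combination (-4 * ((N : ℂ) - m) * gg (N - q - m) * (-2 : ℂ) ^ (N : ℤ) * ((((N : ℤ) - N).toNat.factorial : ℕ) : ℂ) * rf (m - N)) * h2
  · obtain ⟨n, hn⟩ : ∃ n : ℕ, (N : ℤ) - j = ((n + 1 : ℕ) : ℤ) := ⟨((N : ℤ) - j - 1).toNat, by omega⟩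
    rw [show (N : ℤ) - (j + 1) = n by push_cast at hn; omega, hn, zpow_add₀ (by norm_num)]
    have hn' : (N : ℂ) - j = n + 1 := by exact_mod_cast hn
    simp only [Int.toNat_natCast, Nat.factorial_succ]
    push_cast
    rw [hn']
    simp only [zpow_one]
    ring

/-- equation A -/
lemma EZ_A (N : ℕ) (m q : ℤ) (hm : (N : ℤ) < m) (hq : 0 ≤ q) (hq2 : q ≤ 2 * N) (k : ℤ) (j : ℤ)
    (hj : j ≤ N) :
    EZ N m q j (k - 1) + 4 * ((j : ℂ) - m - k) * ((N : ℂ) - q + j - k) * EZ N m q j k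
      + 2 * ((N : ℂ) - j) * EZ N m q (j + 1) k = 0 := by
  rcases lt_or_ge k 0 with h | h
  · simp [EZ_neg N m q _ h, EZ_neg N m q _ (show k - 1 < 0 by omega)]
  obtain ⟨n, rfl⟩ := Int.eq_ofNat_of_zero_le h
  clear h
  induction n generalizing j with
  | zero =>
    have := E0_A N m q hq2 j hj
    have e := EZ_neg N m q j (show ((0 : ℕ) : ℤ) - 1 < 0 by norm_num)
    rw [e, EZ_nat, EZ_nat]
    simp only [EN]
    push_cast
    linear_combination this
  | succ n ih =>
    have i1 := ih j hj
    have i2 := ih (j - 1) (by omega)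
    have a0 := EZ_A' N m q hm hq n j
    have a1 := EZ_A' N m q hm hq (n + 1) j
    have a2 := EZ_A' N m q hm hq (n + 1) (j + 1)
    have d1 := den_ne N m q hm hq n
    have d2 : (n : ℂ) + 1 ≠ 0 := by exact_mod_cast Nat.succ_ne_zero n
    have d3 : 4 * ((n : ℂ) + 1) * ((N : ℂ) - q - m - 1 - n) ≠ 0 :=
      mul_ne_zero (mul_ne_zero (by norm_num) d2) d1
    apply mul_left_cancel₀ d3
    simp only [add_sub_cancel_right, sub_add_cancel, Nat.cast_add, Nat.cast_one] at *
    push_cast at *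
    linear_combination i1 - 2 * ((N : ℂ) + j) * i2 - a0 - 4 * ((j : ℂ) - m - (n + 1)) * ((N : ℂ) - q + j - (n + 1)) * a1
      - 2 * ((N : ℂ) - j) * a2

/-! ### Matching with the explicit sums -/

lemma EN_neg (N : ℕ) (m q : ℤ) (hm : (N : ℤ) < m) (hq : 0 ≤ q) (k : ℕ) (M : ℕ) (hM : M ≤ 2 * N) :
    EN N m q k ((M : ℤ) - N) =
      (-1 : ℂ) ^ ((M : ℤ) - N) * 2 ^ ((M : ℤ) - N - 2 * k) * gg (N - q - m - k) *
        HH (ww N m q) M ((k : ℤ) - M) := by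
  induction k generalizing M with
  | zero =>
    simp only [EN, Nat.cast_zero, zero_sub, HH_top, E0, ww]
    rw [show (N : ℤ) - (M - N) = ((2 * N - M : ℕ) : ℤ) by omega]
    rw [show m - ((M : ℤ) - N) = N + m - M by ring, show q - N - ((M : ℤ) - N) = q - M by ring,
      show (-2 : ℂ) = (-1) * 2 by norm_num, mul_zpow]
    simp only [Int.toNat_natCast, mul_zero, sub_zero]
    ring
  | succ k ih =>
    have h := EN_succ N m q hm hq k ((M : ℤ) - N)
    have d1 := den_ne N m q hm hq k
    have d2 : (k : ℂ) + 1 ≠ 0 := by exact_mod_cast Nat.succ_ne_zero k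
    have d3 : 4 * ((k : ℂ) + 1) * ((N : ℂ) - q - m - 1 - k) ≠ 0 :=
      mul_ne_zero (mul_ne_zero (by norm_num) d2) d1
    apply mul_left_cancel₀ d3
    have g1 := gg_mul (N - q - m - (k + 1 : ℕ))
    rw [show (N : ℤ) - q - m - (k + 1 : ℕ) + 1 = N - q - m - k by push_cast; ring] at g1
    have hr := HH_rec (ww N m q) M ((k : ℤ) + 1 - M)
    rw [show (k : ℤ) + 1 - M - 1 = k - M by ring] at hr
    have z2 : ∀ x : ℤ, (2 : ℂ) ^ (x - 2 * ((k + 1 : ℕ) : ℤ)) = 2 ^ (x - 2 * (k : ℤ)) / 4 := by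
      intro x
      rw [show x - 2 * ((k + 1 : ℕ) : ℤ) = x - 2 * (k : ℤ) - 2 by push_cast; ring, zpow_sub₀ (by norm_num)]
      norm_num
    rw [z2]
    have hk : (((k + 1 : ℕ) : ℤ) - (M : ℤ)) = (k : ℤ) + 1 - M := by push_cast; ring
    rw [hk]
    have i1 := ih M hM
    rw [i1] at h
    rw [← g1] at h
    cases M with
    | zero =>
      push_cast at h hr ⊢
      linear_combination -h + (-1 : ℂ) ^ ((0 : ℤ) - N) * 2 ^ ((0 : ℤ) - N - 2 * k) * ((N : ℂ) - q - m - (k + 1)) * gg ((N : ℤ) - q - m - (k + 1)) * hr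
    | succ M =>
      have i2 := ih M (by omega)
      rw [show (((M + 1 : ℕ) : ℤ) - N - 1) = (M : ℤ) - N by push_cast; ring, i2, ← g1] at h
      have e1 : (-1 : ℂ) ^ (((M + 1 : ℕ) : ℤ) - N) = - (-1 : ℂ) ^ ((M : ℤ) - N) := by
        rw [show (((M + 1 : ℕ) : ℤ) - N) = ((M : ℤ) - N) + 1 by push_cast; ring, zpow_add₀ (by norm_num)]
        simp
      have e2 : (2 : ℂ) ^ (((M + 1 : ℕ) : ℤ) - N - 2 * k) = 2 * (2 : ℂ) ^ ((M : ℤ) - N - 2 * k) := by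
        rw [show (((M + 1 : ℕ) : ℤ) - N - 2 * k) = ((M : ℤ) - N - 2 * k) + 1 by push_cast; ring, zpow_add₀ (by norm_num)]
        simp [mul_comm]
      rw [e1, e2] at h ⊢
      rw [show M + 1 - 1 = M from rfl, show (k : ℤ) + 1 - ((M + 1 : ℕ) : ℤ) = k - M by push_cast; ring] at hr
      rw [show (k : ℤ) + 1 - ((M + 1 : ℕ) : ℤ) = k - M by push_cast; ring]
      push_cast at h hr ⊢
      linear_combination -h - 2 * (-1 : ℂ) ^ ((M : ℤ) - N) * 2 ^ ((M : ℤ) - N - 2 * k) * ((N : ℂ) - q - m - (k + 1)) * gg ((N : ℤ) - q - m - (k + 1)) * hr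

lemma EN_zero (N : ℕ) (m q : ℤ) (k : ℕ) (j : ℤ) (h : (k : ℤ) < N - q + j) :
    EN N m q k j = 0 := by
  induction k generalizing j with
  | zero => simp [EN, E0, rf_neg (show q - N - j < 0 by push_cast at h; omega)]
  | succ k ih =>
    push_cast at h
    simp [EN, ih j (by omega), ih (j - 1) (by omega)]

/-- explicit form for positive `j = N - M` -/
def EP (N : ℕ) (m q : ℤ) (M : ℕ) (k : ℤ) : ℂ :=
  (-1 : ℂ) ^ (q + N) * 2 ^ ((N : ℤ) - M - 2 * k) * gg (N - M - m - k) *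
    (((2 * N - q).toNat.factorial : ℂ) / (q.toNat.factorial : ℂ)) *
    HH (ww N m (2 * N - q)) M (k - (2 * N - q))

lemma EN_diag (N : ℕ) (m q : ℤ) (hm : (N : ℤ) < m) (hq : 0 ≤ q) (hq2 : q ≤ 2 * N) (k : ℕ)
    (hk : (k : ℤ) ≤ 2 * N - q) :
    EN N m q k (q - N + k) = EP N m q (2 * N - q - k).toNat k := by
  obtain ⟨Q, rfl⟩ := Int.eq_ofNat_of_zero_le hq
  have hQk : Q + k ≤ 2 * N := by omega
  obtain ⟨p, hp⟩ : ∃ p : ℕ, m + Q - N = p := ⟨(m + Q - N).toNat, by omega⟩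
  have v : EN N m Q k ((Q : ℤ) - N + k) = (-1 : ℂ) ^ (p : ℤ) * (-2 : ℂ) ^ ((Q : ℤ) - N) *
      ((2 * N - Q).factorial : ℂ) * rf (m + N - Q) *
      (2 ^ k)⁻¹ * ((Q + k).factorial : ℂ) / (Q.factorial : ℂ) * rf k * rf (p + k) := by
    clear hk hQk
    have hQf : (Q.factorial : ℂ) ≠ 0 := by exact_mod_cast Q.factorial_ne_zero
    induction k with
    | zero =>
      simp only [EN, E0, gg]
      rw [show -((N : ℤ) - Q - m) = p by omega, show (N : ℤ) - Q - m = -(p : ℤ) by omega,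
        show (N : ℤ) - (Q - N + (0 : ℕ)) = ((2 * N - Q : ℕ) : ℤ) by push_cast; omega,
        show m - ((Q : ℤ) - N + (0 : ℕ)) = m + N - Q by push_cast; ring,
        show (Q : ℤ) - N - (Q - N + (0 : ℕ)) = ((0 : ℕ) : ℤ) by push_cast; ring, rf_natCast 0]
      have : (-1 : ℂ) ^ (-(p : ℤ)) = (-1 : ℂ) ^ (p : ℤ) := by
        rw [zpow_neg, ← inv_zpow]; norm_num
      rw [this]
      simp
      field_simp
    | succ k ih =>
      have h := EN_succ N m Q hm hq k ((Q : ℤ) - N + (k + 1 : ℕ))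
      rw [EN_zero N m Q k _ (by push_cast; omega),
        show (Q : ℤ) - N + (k + 1 : ℕ) - 1 = (Q : ℤ) - N + k by push_cast; ring, ih] at h
      have d1 := den_ne N m Q hm hq k
      have d2 : (k : ℂ) + 1 ≠ 0 := by exact_mod_cast Nat.succ_ne_zero k
      have d3 : 4 * ((k : ℂ) + 1) * ((N : ℂ) - (Q : ℤ) - m - 1 - k) ≠ 0 :=
        mul_ne_zero (mul_ne_zero (by norm_num) d2) d1
      apply mul_left_cancel₀ d3
      have r1 := rf_mul ((k + 1 : ℕ) : ℤ)
      have r2 := rf_mul (p + (k + 1 : ℕ) : ℤ)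
      rw [show (((k + 1 : ℕ) : ℤ) - 1) = (k : ℤ) by push_cast; ring] at r1
      rw [show ((p : ℤ) + ((k + 1 : ℕ) : ℤ) - 1) = (p : ℤ) + k by push_cast; ring] at r2
      rw [← r1, ← r2] at h
      have hp' : (p : ℂ) = m + Q - N := by exact_mod_cast hp.symm
      rw [show Q + (k + 1) = (Q + k) + 1 by ring, Nat.factorial_succ]
      generalize rf ((k + 1 : ℕ) : ℤ) = R1 at *
      generalize rf (p + (k + 1 : ℕ) : ℤ) = R2 at *
      rw [pow_succ, mul_inv]
      push_cast at h ⊢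
      rw [hp'] at h
      linear_combination -h
  rw [v, EP]
  have e : ((2 * N - Q - k : ℤ)).toNat = 2 * N - Q - k := by omega
  have hM : (k : ℤ) - (2 * N - Q) = -(((2 * N - Q - k : ℕ)) : ℤ) := by omega
  have e3 : 2 * (N : ℤ) - Q = ((2 * N - Q : ℕ) : ℤ) := by omega
  rw [e, hM, HH_top, ww, show 2 * N - (2 * N - Q - k) = Q + k by omega,
    show (N : ℤ) + m - ((2 * N - Q - k : ℕ) : ℤ) = p + k by omega,
    show 2 * (N : ℤ) - Q - ((2 * N - Q - k : ℕ) : ℤ) = k by omega,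
    show (N : ℤ) - ((2 * N - Q - k : ℕ) : ℤ) - 2 * k = (Q - N) - k by omega,
    show (N : ℤ) - ((2 * N - Q - k : ℕ) : ℤ) - m - k = -(m + N - Q) by omega, gg, neg_neg, e3]
  simp only [Int.toNat_natCast]
  rw [zpow_sub₀ (by norm_num) ((Q : ℤ) - N) k, zpow_natCast (2 : ℂ) k,
    show (-2 : ℂ) = (-1) * 2 by norm_num, mul_zpow]
  have s : (-1 : ℂ) ^ (p : ℤ) * (-1) ^ ((Q : ℤ) - N) = (-1) ^ ((Q : ℤ) + N) * (-1) ^ (-(m + N - Q)) := by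
    rw [← zpow_add₀ (by norm_num), ← zpow_add₀ (by norm_num),
      show (Q : ℤ) + N + -(m + N - Q) = (p + (Q - N)) + 2 * (N - m) by omega,
      zpow_add₀ (by norm_num) _ (2 * (N - m)), zpow_mul]
    norm_num
  have hQf : (Q.factorial : ℂ) ≠ 0 := by exact_mod_cast Q.factorial_ne_zero
  linear_combination ((2 * N - Q).factorial : ℂ) * rf (m + N - Q) * ((Q + k).factorial : ℂ) * rf k * rf (p + k) * 2 ^ ((Q : ℤ) - N) * (2 ^ k)⁻¹ / (Q.factorial : ℂ) * s

lemma EP_neg (N : ℕ) (m q : ℤ) (M : ℕ) {k : ℤ} (hk : k < 0) : EP N m q M k = 0 := by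
  unfold EP HH
  rw [sum_eq_zero, mul_zero]
  intro r _
  unfold ww
  rcases lt_or_ge (2 * (N : ℤ) - q - r) 0 with h | h
  · rw [rf_neg h]; simp
  · rw [rf_neg (x := k - (2 * N - q) + r) (by omega)]; simp

lemma EP_A (N : ℕ) (m q : ℤ) (k : ℤ) (M : ℕ) :
    EP N m q M (k - 1) + 4 * ((N : ℂ) - M - m - k) * ((N : ℂ) - q + (N - M) - k) * EP N m q M k
      + 2 * (M : ℂ) * EP N m q (M - 1) k = 0 := by
  have hr := HH_rec (ww N m (2 * N - q)) M (k - (2 * N - q))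
  have g1 := gg_mul (N - M - m - k)
  have z2 : (2 : ℂ) ^ ((N : ℤ) - M - 2 * (k - 1)) = 4 * 2 ^ ((N : ℤ) - M - 2 * k) := by
    rw [show (N : ℤ) - M - 2 * (k - 1) = (N : ℤ) - M - 2 * k + 2 by ring, zpow_add₀ (by norm_num)]
    norm_num [mul_comm]
  unfold EP
  rw [z2, show (N : ℤ) - M - m - (k - 1) = N - M - m - k + 1 by ring, ← g1,
    show k - 1 - (2 * (N : ℤ) - q) = k - (2 * N - q) - 1 by ring]
  cases M with
  | zero =>
    push_cast at hr ⊢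
    linear_combination ((-1 : ℂ) ^ (q + N) * (4 * 2 ^ ((N : ℤ) - 0 - 2 * k)) * (((N : ℂ) - 0 - m - k) * gg ((N : ℤ) - 0 - m - k)) *
    (((2 * N - q).toNat.factorial : ℂ) / (q.toNat.factorial : ℂ))) * hr
  | succ M =>
    rw [show M + 1 - 1 = M from rfl] at *
    rw [show (N : ℤ) - M - m - k = (N : ℤ) - (M + 1 : ℕ) - m - k + 1 by push_cast; ring, ← g1]
    have e2 : (2 : ℂ) ^ ((N : ℤ) - M - 2 * k) = 2 * (2 : ℂ) ^ ((N : ℤ) - (M + 1 : ℕ) - 2 * k) := by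
      rw [show (N : ℤ) - M - 2 * k = (N : ℤ) - (M + 1 : ℕ) - 2 * k + 1 by push_cast; ring, zpow_add₀ (by norm_num)]
      simp [mul_comm]
    rw [e2]
    push_cast at hr ⊢
    linear_combination ((-1 : ℂ) ^ (q + N) * (4 * 2 ^ ((N : ℤ) - (M + 1) - 2 * k)) * (((N : ℂ) - (M + 1) - m - k) * gg ((N : ℤ) - (M + 1) - m - k)) *
    (((2 * N - q).toNat.factorial : ℂ) / (q.toNat.factorial : ℂ))) * hr

lemma EZ_pos (N : ℕ) (m q : ℤ) (hm : (N : ℤ) < m) (hq : 0 ≤ q) (hq2 : q ≤ 2 * N) (M : ℕ)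
    (k : ℤ) (hk : -1 ≤ k) : EZ N m q (N - M) k = EP N m q M k := by
  induction M generalizing k with
  | zero =>
    induction k, hk using Int.leInduction with
    | base => rw [EZ_neg _ _ _ _ (by norm_num), EP_neg _ _ _ _ (by norm_num)]
    | succ k hk ih =>
      by_cases h : k + 1 = N - q + (N - (0 : ℕ))
      · obtain ⟨n, hn⟩ : ∃ n : ℕ, k + 1 = n := ⟨(k + 1).toNat, by omega⟩
        have := EN_diag N m q hm hq hq2 n (by omega)
        rw [hn, EZ_nat]
        rw [show (N : ℤ) - (0 : ℕ) = q - N + n by omega, this]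
        congr 1; omega
      · have a1 := EZ_A N m q hm hq hq2 (k + 1) (N - (0 : ℕ)) (by omega)
        have a2 := EP_A N m q (k + 1) 0
        rw [show k + 1 - 1 = k by ring] at a1 a2
        rw [ih] at a1
        have d1 : (N : ℂ) - q + (N - (0 : ℕ)) - (k + 1) ≠ 0 := by
          intro h'
          apply h
          have : (N : ℤ) - q + (N - (0 : ℕ)) - (k + 1) = 0 := by exact_mod_cast h'
          omega
        have d2 : (N : ℂ) - (0 : ℕ) - m - (k + 1) ≠ 0 := by
          have : (N : ℤ) - (0 : ℕ) - m - (k + 1) ≠ 0 := by omega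
          exact_mod_cast this
        apply mul_left_cancel₀ (mul_ne_zero d1 d2)
        push_cast at a1 a2 ⊢
        linear_combination (a1 - a2) / 4
  | succ M ihM =>
    induction k, hk using Int.leInduction with
    | base => rw [EZ_neg _ _ _ _ (by norm_num), EP_neg _ _ _ _ (by norm_num)]
    | succ k hk ih =>
      by_cases h : k + 1 = N - q + (N - (M + 1 : ℕ))
      · obtain ⟨n, hn⟩ : ∃ n : ℕ, k + 1 = n := ⟨(k + 1).toNat, by omega⟩
        have := EN_diag N m q hm hq hq2 n (by omega)
        rw [hn, EZ_nat]
        rw [show (N : ℤ) - (M + 1 : ℕ) = q - N + n by omega, this]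
        congr 1; omega
      · have a1 := EZ_A N m q hm hq hq2 (k + 1) (N - (M + 1 : ℕ)) (by omega)
        have a2 := EP_A N m q (k + 1) (M + 1)
        rw [show k + 1 - 1 = k by ring] at a1 a2
        rw [ih, show (N : ℤ) - (M + 1 : ℕ) + 1 = N - M by push_cast; ring, ihM (k + 1) (by omega)] at a1
        have d1 : (N : ℂ) - q + (N - (M + 1 : ℕ)) - (k + 1) ≠ 0 := by
          intro h'
          apply h
          have : (N : ℤ) - q + (N - (M + 1 : ℕ)) - (k + 1) = 0 := by exact_mod_cast h'
          omega
        have d2 : (N : ℂ) - (M + 1 : ℕ) - m - (k + 1) ≠ 0 := by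
          have : (N : ℤ) - (M + 1 : ℕ) - m - (k + 1) ≠ 0 := by omega
          exact_mod_cast this
        apply mul_left_cancel₀ (mul_ne_zero d1 d2)
        rw [show M + 1 - 1 = M from rfl] at a2
        push_cast at a1 a2 ⊢
        linear_combination (a1 - a2) / 4

/-! ### Coefficients of the explicit tuple -/

/-- normalized coefficient -/
def ec (p : ℂ[X]) (n : ℕ) : ℂ := p.coeff n * (n.factorial : ℂ)

lemma ec_C_mul (c : ℂ) (p : ℂ[X]) (n : ℕ) : ec (C c * p) n = c * ec p n := by
  simp [ec, mul_assoc]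

lemma ec_sum {ι : Type*} (s : Finset ι) (p : ι → ℂ[X]) (n : ℕ) :
    ec (∑ i ∈ s, p i) n = ∑ i ∈ s, ec (p i) n := by
  simp [ec, sum_mul]

lemma ec_eq_zero {p : ℂ[X]} {n : ℕ} : ec p n = 0 ↔ p.coeff n = 0 := by
  have h2 : (n.factorial : ℂ) ≠ 0 := by exact_mod_cast n.factorial_ne_zero
  simp [ec, h2]

lemma ec_zero (n : ℕ) : ec 0 n = 0 := by simp [ec]

lemma gegenC_coeff (μ : ℂ) (L n : ℕ) : (gegenC μ L).coeff n =
    ∑ k ∈ range (L / 2 + 1),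
      ((-1 : ℂ) ^ k / ((k.factorial : ℂ) * ((L - 2 * k).factorial : ℂ)) *
        ∏ s ∈ range (L / 2 - k), (μ + (((L + 1) / 2 : ℕ) : ℂ) + (s : ℂ))) *
      (if n = L - 2 * k then 2 ^ (L - 2 * k) else 0) := by
  unfold gegenC
  rw [finsetSum_coeff]
  refine sum_congr rfl fun k _ => ?_
  rw [coeff_C_mul, mul_pow, ← C_pow, coeff_C_mul, coeff_X_pow]
  simp

lemma gegenCit_par (μ : ℂ) (l : ℤ) (n : ℕ) (h : ¬ ∃ k : ℤ, l = n + 2 * k) :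
    ec (gegenCit μ l) n = 0 := by
  rw [ec_eq_zero]
  unfold gegenCit gegenCZ
  rw [comp_C_mul_X_coeff]
  split_ifs with h0
  · rw [gegenC_coeff, sum_eq_zero, zero_mul]
    intro k hk
    rw [if_neg, mul_zero]
    intro hn
    simp at hk
    exact h ⟨k, by omega⟩
  · simp

lemma gegenCit_ec (μ : ℂ) (l : ℤ) (n : ℕ) (k : ℤ) (h : l = n + 2 * k) :
    ec (gegenCit μ l) n = Complex.I ^ l * 2 ^ n * rf k *
      ∏ s ∈ range (n / 2), (μ + (((l + 1) / 2 : ℤ) : ℂ) + (s : ℂ)) := by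
  rcases lt_or_ge k 0 with hk | hk
  · rw [rf_neg hk, mul_zero, zero_mul, ec_eq_zero]
    unfold gegenCit gegenCZ
    rw [comp_C_mul_X_coeff]
    split_ifs with h0
    · rw [gegenC_coeff, sum_eq_zero, zero_mul]
      intro k hk
      rw [if_neg, mul_zero]
      omega
    · simp
  · obtain ⟨K, rfl⟩ := Int.eq_ofNat_of_zero_le hk
    obtain rfl : l = ((n + 2 * K : ℕ) : ℤ) := by push_cast; exact h
    unfold ec gegenCit gegenCZ
    rw [comp_C_mul_X_coeff, if_pos (by positivity), gegenC_coeff, Int.toNat_natCast,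
      sum_eq_single K]
    · rw [if_pos (by omega), show n + 2 * K - 2 * K = n by omega,
        show (n + 2 * K) / 2 - K = n / 2 by omega, rf_natCast,
        show ((((n + 2 * K : ℕ) : ℤ) + 1) / 2 : ℤ) = (((n + 2 * K + 1) / 2 : ℕ) : ℤ) by push_cast; rfl,
        zpow_natCast, pow_add, pow_mul, Complex.I_sq]
      have h1 : (n.factorial : ℂ) ≠ 0 := by exact_mod_cast n.factorial_ne_zero
      have h2 : (K.factorial : ℂ) ≠ 0 := by exact_mod_cast K.factorial_ne_zero
      rw [Int.cast_natCast]
      field_simp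
    · intro b hb hbk
      simp at hb
      rw [if_neg (by omega), mul_zero]
    · intro hK
      simp at hK
      omega

/-- the overall constant -/
def KK (N a : ℕ) (m q : ℤ) : ℂ :=
  Complex.I ^ ((a : ℤ) - m) * (-1 : ℂ) ^ (N : ℤ) * 2 ^ ((a : ℤ) - m) *
    ((((N : ℤ) + m).toNat.factorial : ℂ) * (q.toNat.factorial : ℂ) /
      (gg ((N : ℤ) + 1 - a - q + ((a : ℤ) - m - 1) / 2) * (N.factorial : ℂ)))

lemma neg_one_zpow_congr {x y : ℤ} (h : ∃ d : ℤ, x = y + 2 * d) : (-1 : ℂ) ^ x = (-1 : ℂ) ^ y := by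
  obtain ⟨d, rfl⟩ := h
  rw [zpow_add₀ (by norm_num), zpow_mul]
  norm_num

lemma I_zpow_two (x : ℤ) : Complex.I ^ (2 * x) = (-1 : ℂ) ^ x := by
  rw [zpow_mul]; norm_num [zpow_ofNat]

lemma EZ_neg' (N : ℕ) (m q : ℤ) (hm : (N : ℤ) < m) (hq : 0 ≤ q) (k : ℤ) (M : ℕ) (hM : M ≤ 2 * N) :
    EZ N m q ((M : ℤ) - N) k =
      (-1 : ℂ) ^ ((M : ℤ) - N) * 2 ^ ((M : ℤ) - N - 2 * k) * gg (N - q - m - k) *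
        HH (ww N m q) M (k - M) := by
  rcases lt_or_ge k 0 with h | h
  · rw [EZ_neg N m q _ h, HH, sum_eq_zero, mul_zero]
    intro r hr
    simp at hr
    rw [rf_neg (by omega), mul_zero]
  · obtain ⟨n, rfl⟩ := Int.eq_ofNat_of_zero_le h
    rw [EZ_nat, EN_neg N m q hm hq n M hM]

lemma EZ_pos' (N : ℕ) (m q : ℤ) (hm : (N : ℤ) < m) (hq : 0 ≤ q) (hq2 : q ≤ 2 * N) (M : ℕ)
    (k : ℤ) : EZ N m q (N - M) k = EP N m q M k := by
  rcases lt_or_ge k 0 with h | h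
  · rw [EZ_neg N m q _ h, EP_neg N m q M h]
  · exact EZ_pos N m q hm hq hq2 M k (by omega)

set_option maxHeartbeats 2000000 in
lemma F1_neg (N a : ℕ) (m q : ℤ) (hm : (N : ℤ) < m)
    (hq : 0 ≤ q) (hq1 : (N : ℤ) - a + m ≤ q) (M : ℕ) (hM : M ≤ N) (n : ℕ) (k : ℤ)
    (hn : (n : ℤ) = a - m + ((M : ℤ) - N) - 2 * k) :
    ec (F1 N a m q ((M : ℤ) - N)) n = KK N a m q * EZ N m q ((M : ℤ) - N) k := by
  have e1 : (-((M : ℤ) - N)).toNat = N - M := by omega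
  have e2 : N - (N - M) = M := by omega
  have e3 : 2 * N - (N + (N - M)) = M := by omega
  unfold F1
  simp only
  rw [if_neg (by omega), if_pos (by omega), EZ_neg' N m q hm hq k M (by omega), ec_C_mul, ec_sum, e1, e2,
    HH, mul_sum, mul_sum, mul_sum]
  refine sum_congr rfl fun r hr => ?_
  have hr' : r ≤ M := by simp at hr; omega
  rw [ec_C_mul, gegenCit_ec _ _ n (k - M + r) (by omega)]
  set c : ℤ := (N : ℤ) + 1 - a - q + ((a : ℤ) - m - 1) / 2 with hc
  have hc0 : c ≤ 0 := by omega
  set z : ℤ := (N : ℤ) + 1 - a - q + ((a : ℤ) - m + (N - M) - 1) / 2 with hz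
  have hz0 : z ≤ 0 := by omega
  have hzz : (((N : ℤ) + 1 - a - q : ℤ) : ℂ) + (N : ℂ) - 1 - (r : ℂ) +
      ((((a : ℤ) - m + -((M : ℤ) - N) - 2 * N + 2 * r + 1) / 2 : ℤ) : ℂ) = (z : ℂ) := by
    have : ((N : ℤ) + 1 - a - q) + N - 1 - r + (((a : ℤ) - m + -((M : ℤ) - N) - 2 * N + 2 * r + 1) / 2) = z := by
      omega
    exact_mod_cast this
  simp only [hzz]
  have hp := gg_prod z (n / 2)
  rw [show z + ((n / 2 : ℕ) : ℤ) = N - q - m - k by push_cast; omega] at hp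
  have gz := gg_ne hz0
  have gc := gg_ne hc0
  rw [← hp]
  generalize (∏ i ∈ range (n / 2), ((z : ℂ) + (i : ℂ))) = P
  unfold Bcoef GammaAB
  rw [e3]
  have hgq : gq ((N : ℤ) + 1 - a - q + ((N : ℤ) + 1 - q - (N + 1 - a - q) - m + N - M - 1) / 2)
      ((N : ℤ) + 1 - a - q + ((N : ℤ) + 1 - q - (N + 1 - a - q) - m - 1) / 2) = gg z / gg c := by
    rw [show (N : ℤ) + 1 - a - q + ((N : ℤ) + 1 - q - (N + 1 - a - q) - m + N - M - 1) / 2 = z by omega,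
      show (N : ℤ) + 1 - a - q + ((N : ℤ) + 1 - q - (N + 1 - a - q) - m - 1) / 2 = c by omega]
    exact gq_eq hz0 hc0
  rw [hgq]
  have hf1 := fall_prodZ ((N : ℤ) + m) (by omega) r
  have hf2 := fall_prodZ q hq r
  have hf1' : ∀ i : ℕ, (((N : ℤ) + m : ℤ) : ℂ) - (i : ℂ) = (N : ℂ) + m - i := by intro i; push_cast; ring
  have hf2' : ∀ i : ℕ, (N : ℂ) - (((N : ℤ) + 1 - q : ℤ) : ℂ) + 2 - ((i : ℂ) + 1) = (q : ℂ) - i := by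
    intro i; push_cast; ring
  simp only [hf1'] at hf1
  simp only [hf2', hf1, hf2]
  have i1 : Complex.I ^ ((M : ℤ) - N) * Complex.I ^ ((a : ℤ) - m + -((M : ℤ) - N) - 2 * N + 2 * r)
      = Complex.I ^ ((a : ℤ) - m) * (-1) ^ ((r : ℤ) - N) := by
    rw [← I_zpow_two, ← zpow_add₀ Complex.I_ne_zero, ← zpow_add₀ Complex.I_ne_zero]
    congr 1; ring
  have i2 : (-1 : ℂ) ^ ((r : ℤ) - N) * (-1) ^ r * (-1) ^ ((((N + (N - M) : ℕ)) : ℤ) - N) =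
      (-1 : ℂ) ^ (N : ℤ) * (-1) ^ ((M : ℤ) - N) := by
    rw [← zpow_natCast (-1 : ℂ) r, ← zpow_add₀ (by norm_num), ← zpow_add₀ (by norm_num), ← zpow_add₀ (by norm_num)]
    apply neg_one_zpow_congr
    exact ⟨r - M, by omega⟩
  have i3 : (2 : ℂ) ^ n = 2 ^ ((a : ℤ) - m) * 2 ^ ((M : ℤ) - N - 2 * k) := by
    rw [← zpow_natCast, hn, ← zpow_add₀ (by norm_num)]
    congr 1; ring
  rw [i3]
  unfold KK ww
  rw [← hc]
  generalize Complex.I ^ ((M : ℤ) - N) = X1 at *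
  generalize Complex.I ^ ((a : ℤ) - m + -((M : ℤ) - N) - 2 * N + 2 * r) = X2 at *
  generalize Complex.I ^ ((a : ℤ) - m) = X3 at *
  generalize (-1 : ℂ) ^ ((r : ℤ) - N) = Y1 at *
  generalize (-1 : ℂ) ^ r = Y2 at *
  generalize (-1 : ℂ) ^ ((((N + (N - M) : ℕ)) : ℤ) - N) = Y3 at *
  generalize (-1 : ℂ) ^ (N : ℤ) = Y4 at *
  generalize (-1 : ℂ) ^ ((M : ℤ) - N) = Y5 at *
  generalize (2 : ℂ) ^ ((M : ℤ) - N - 2 * k) = T1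
  generalize (2 : ℂ) ^ ((a : ℤ) - m) = T2
  generalize gg z = G1 at *
  generalize gg c = G2 at *
  generalize rf (k - M + r) = R1
  generalize rf ((N : ℤ) + m - r) = R2
  generalize rf (q - r) = R3
  have hNf : (N.factorial : ℂ) ≠ 0 := by exact_mod_cast N.factorial_ne_zero
  field_simp
  generalize ((((N : ℤ) + m).toNat.factorial : ℕ) : ℂ) = Z1
  generalize ((q.toNat.factorial : ℕ) : ℂ) = Z2
  generalize (((2 * N - r).factorial : ℕ) : ℂ) = Z3
  generalize ((M.choose r : ℕ) : ℂ) = Z4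
  linear_combination (R1 * R2 * R3 * T1 * T2 * Z1 * Z2 * Z3 * Z4 * P) * (Y2 * Y3 * i1 + X3 * i2)

set_option maxHeartbeats 2000000 in
lemma F1_pos (N a : ℕ) (m q : ℤ) (hm : (N : ℤ) < m)
    (hq : 0 ≤ q) (hq1 : (N : ℤ) - a + m ≤ q) (hq2 : q ≤ 2 * N) (M : ℕ) (hM : M < N) (n : ℕ) (k : ℤ)
    (hn : (n : ℤ) = a - m + ((N : ℤ) - M) - 2 * k) :
    ec (F1 N a m q ((N : ℤ) - M)) n = KK N a m q * EZ N m q ((N : ℤ) - M) k := by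
  have e1 : ((N : ℤ) - M).toNat = N - M := by omega
  have e2 : N - (N - M) = M := by omega
  unfold F1
  simp only
  rw [if_pos (by omega), EZ_pos' N m q hm hq hq2 M k, ec_C_mul, ec_sum, e1, e2, EP,
    HH, mul_sum, mul_sum, mul_sum]
  refine sum_congr rfl fun r hr => ?_
  have hr' : r ≤ M := by simp at hr; omega
  rw [ec_C_mul, gegenCit_ec _ _ n (k - (2 * N - q) + r) (by omega)]
  set c : ℤ := (N : ℤ) + 1 - a - q + ((a : ℤ) - m - 1) / 2 with hc
  have hc0 : c ≤ 0 := by omega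
  set y : ℤ := (N : ℤ) + 1 - a - q + ((a : ℤ) - m + (N - M) - 1) / 2 with hy
  have hy0 : y ≤ 0 := by omega
  set z : ℤ := y + q - N with hz
  have hz0 : z ≤ 0 := by omega
  have hzz : (((N : ℤ) + 1 - a - q : ℤ) : ℂ) + (N : ℂ) - 1 - (r : ℂ) +
      ((((a : ℤ) - m + ((N : ℤ) - M) + 2 * (1 - N - (N + 1 - q) + r) + 1) / 2 : ℤ) : ℂ) = (z : ℂ) := by
    have : ((N : ℤ) + 1 - a - q) + N - 1 - r + (((a : ℤ) - m + ((N : ℤ) - M) + 2 * (1 - N - (N + 1 - q) + r) + 1) / 2) = z := by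
      omega
    exact_mod_cast this
  simp only [hzz]
  have hp := gg_prod z (n / 2)
  rw [show z + ((n / 2 : ℕ) : ℤ) = N - M - m - k by push_cast; omega] at hp
  have gz := gg_ne hz0
  have gy := gg_ne hy0
  have gc := gg_ne hc0
  rw [← hp]
  generalize (∏ i ∈ range (n / 2), ((z : ℂ) + (i : ℂ))) = P
  unfold Acoef GammaAB
  have y1 : (N : ℤ) + 1 - a - q + ((N : ℤ) + 1 - q - (N + 1 - a - q) - m + N - M - 1) / 2 = y := by omega
  have y2 : (N : ℤ) + 1 - a - q + (-((N : ℤ) + 1 - q) - (N + 1 - a - q) - m + N - M + 1) / 2 = z := by omega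
  have y3 : (N : ℤ) + 1 - a - q + ((N : ℤ) + 1 - q - (N + 1 - a - q) - m - 1) / 2 = c := by omega
  rw [y1, y2, y3, gq_eq hy0 hc0, gq_eq hz0 hy0]
  have hf1 := fall_prodZ ((N : ℤ) + m) (by omega) r
  have hf2 := fall_prodZ (2 * N - q) (by omega) r
  have hf1' : ∀ i : ℕ, (((N : ℤ) + m : ℤ) : ℂ) - (i : ℂ) = (N : ℂ) + m - i := by intro i; push_cast; ring
  have hf2' : ∀ i : ℕ, (N : ℂ) + (((N : ℤ) + 1 - q : ℤ) : ℂ) - ((i : ℂ) + 1) = ((2 * N - q : ℤ) : ℂ) - i := by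
    intro i; push_cast; ring
  simp only [hf1'] at hf1
  simp only [hf2', hf1, hf2]
  have i1 : Complex.I ^ (-((N : ℤ) - M)) * Complex.I ^ ((a : ℤ) - m + ((N : ℤ) - M) + 2 * (1 - N - (N + 1 - q) + r))
      = Complex.I ^ ((a : ℤ) - m) * (-1) ^ (1 - (N : ℤ) - (N + 1 - q) + r) := by
    rw [← I_zpow_two, ← zpow_add₀ Complex.I_ne_zero, ← zpow_add₀ Complex.I_ne_zero]
    congr 1; ring
  have i2 : (-1 : ℂ) ^ (1 - (N : ℤ) - (N + 1 - q) + r) * (-1) ^ r * ((-1) ^ ((N : ℤ) + 1 - q - 1) * (-1) ^ ((N : ℤ) + 1 - q - 1)) =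
      (-1 : ℂ) ^ (N : ℤ) * (-1) ^ (q + (N : ℤ)) := by
    rw [← zpow_natCast (-1 : ℂ) r, ← zpow_add₀ (by norm_num), ← zpow_add₀ (by norm_num), ← zpow_add₀ (by norm_num),
      ← zpow_add₀ (by norm_num)]
    apply neg_one_zpow_congr
    exact ⟨r - q - N, by ring⟩
  have i3 : (2 : ℂ) ^ n = 2 ^ ((a : ℤ) - m) * 2 ^ ((N : ℤ) - M - 2 * k) := by
    rw [← zpow_natCast, hn, ← zpow_add₀ (by norm_num)]
    congr 1; ring
  rw [i3]
  unfold KK ww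
  rw [← hc]
  clear hp hzz y1 y2 y3 hf1 hf2 hf1' hf2' i3
  generalize Complex.I ^ (-((N : ℤ) - M)) = X1 at *
  generalize Complex.I ^ ((a : ℤ) - m + ((N : ℤ) - M) + 2 * (1 - N - (N + 1 - q) + r)) = X2 at *
  generalize Complex.I ^ ((a : ℤ) - m) = X3 at *
  generalize (-1 : ℂ) ^ (1 - (N : ℤ) - (N + 1 - q) + r) = Y1 at *
  generalize (-1 : ℂ) ^ r = Y2 at *
  generalize (-1 : ℂ) ^ ((N : ℤ) + 1 - q - 1) = Y3 at *
  generalize (-1 : ℂ) ^ (N : ℤ) = Y4 at *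
  generalize (-1 : ℂ) ^ (q + (N : ℤ)) = Y5 at *
  generalize (2 : ℂ) ^ ((N : ℤ) - M - 2 * k) = T1
  generalize (2 : ℂ) ^ ((a : ℤ) - m) = T2
  generalize gg z = G1 at *
  generalize gg c = G2 at *
  generalize gg y = G3 at *
  generalize rf (k - (2 * N - q) + r) = R1
  generalize rf ((N : ℤ) + m - r) = R2
  generalize rf (2 * N - q - r) = R3
  have hNf : (N.factorial : ℂ) ≠ 0 := by exact_mod_cast N.factorial_ne_zero
  have hqf : (q.toNat.factorial : ℂ) ≠ 0 := by exact_mod_cast q.toNat.factorial_ne_zero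
  field_simp
  generalize ((((N : ℤ) + m).toNat.factorial : ℕ) : ℂ) = Z1
  generalize (((2 * (N : ℤ) - q).toNat.factorial : ℕ) : ℂ) = Z2
  generalize (((2 * N - r).factorial : ℕ) : ℂ) = Z3
  generalize ((M.choose r : ℕ) : ℂ) = Z4
  linear_combination (R1 * R2 * R3 * T1 * T2 * Z1 * Z2 * Z3 * Z4 * P) * (Y2 * Y3 * Y3 * i1 + X3 * i2)

lemma F1_ec (N a : ℕ) (m q : ℤ) (hm : (N : ℤ) < m)
    (hq : 0 ≤ q) (hq1 : (N : ℤ) - a + m ≤ q) (hq2 : q ≤ 2 * N) (j : ℤ) (hj : |j| ≤ N) (n : ℕ) (k : ℤ)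
    (hn : (n : ℤ) = a - m + j - 2 * k) :
    ec (F1 N a m q j) n = KK N a m q * EZ N m q j k := by
  rw [abs_le] at hj
  rcases le_or_gt j 0 with h | h
  · obtain ⟨M, hM⟩ : ∃ M : ℕ, j = (M : ℤ) - N := ⟨(j + N).toNat, by omega⟩
    subst hM
    exact F1_neg N a m q hm hq hq1 M (by omega) n k hn
  · obtain ⟨M, hM⟩ : ∃ M : ℕ, j = (N : ℤ) - M := ⟨(N - j).toNat, by omega⟩
    subst hM
    exact F1_pos N a m q hm hq hq1 hq2 M (by omega) n k hn

lemma F1_par (N a : ℕ) (m q : ℤ) (j : ℤ) (n : ℕ) (h : ¬ ∃ k : ℤ, (n : ℤ) = a - m + j - 2 * k) :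
    ec (F1 N a m q j) n = 0 := by
  unfold F1
  simp only
  split_ifs with h1 h2
  · rw [ec_C_mul, ec_sum, sum_eq_zero, mul_zero]
    intro r _
    rw [ec_C_mul, gegenCit_par, mul_zero]
    rintro ⟨k, hk⟩
    exact h ⟨k - (1 - (N : ℤ) - (N + 1 - q) + r), by linarith⟩
  · rw [ec_C_mul, ec_sum, sum_eq_zero, mul_zero]
    intro r _
    rw [ec_C_mul, gegenCit_par, mul_zero]
    rintro ⟨k, hk⟩
    exact h ⟨k + N - r + j, by linarith⟩
  · exact ec_zero n

lemma F1_out (N a : ℕ) (m q : ℤ) (j : ℤ) (hj : (N : ℤ) < |j|) : F1 N a m q j = 0 := by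
  unfold F1
  simp only
  rw [if_neg, if_neg]
  · rintro ⟨h1, h2⟩
    exact absurd (abs_le.2 ⟨h1, by omega⟩) (not_le.2 hj)
  · rintro ⟨h1, h2⟩
    exact absurd (abs_le.2 ⟨by omega, h2⟩) (not_le.2 hj)

/-! ### Reduction of the system to recurrences -/

lemma ec_add (p r : ℂ[X]) (n : ℕ) : ec (p + r) n = ec p n + ec r n := by simp [ec, add_mul]

lemma ec_sub (p r : ℂ[X]) (n : ℕ) : ec (p - r) n = ec p n - ec r n := by simp [ec, sub_mul]

lemma ec_der (p : ℂ[X]) (n : ℕ) : ec (derivative p) n = ec p (n + 1) := by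
  unfold ec
  rw [coeff_derivative, Nat.factorial_succ]
  push_cast
  ring

lemma ec_Xder (p : ℂ[X]) (n : ℕ) : ec (X * derivative p) n = n * ec p n := by
  cases n with
  | zero => simp [ec]
  | succ n =>
    unfold ec
    rw [coeff_X_mul, coeff_derivative]
    push_cast
    ring

lemma ec_X2der (p : ℂ[X]) (n : ℕ) :
    ec (X ^ 2 * derivative (derivative p)) n = n * (n - 1) * ec p n := by
  have : X ^ 2 * derivative (derivative p) =
      X * derivative (X * derivative p) - X * derivative p := by
    simp only [derivative_mul, derivative_X]
    ring
  rw [this, ec_sub, ec_Xder, ec_Xder]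
  ring

lemma ec_gegenS (μ : ℂ) (l : ℤ) (p : ℂ[X]) (n : ℕ) :
    ec (gegenS μ l p) n = -(ec p (n + 2) + ((n : ℂ) - l) * (n + l + 2 * μ) * ec p n) := by
  have : gegenS μ l p = C (-1) * (derivative (derivative p) + X ^ 2 * derivative (derivative p)
      + C (1 + 2 * μ) * (X * derivative p) - C ((l : ℂ) * ((l : ℂ) + 2 * μ)) * p) := by
    unfold gegenS
    simp only [map_add, map_mul, map_neg, map_one]
    rw [show (C (2 : ℂ)) = 2 from rfl]
    ring
  rw [this, ec_C_mul, ec_sub, ec_add, ec_add, ec_C_mul, ec_C_mul, ec_der, ec_der, ec_X2der, ec_Xder]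
  ring

lemma poly_zero_iff (p : ℂ[X]) : p = 0 ↔ ∀ n, ec p n = 0 := by
  rw [Polynomial.ext_iff]
  simp [ec_eq_zero]

/-- Recurrence `A`. -/
def RecA (lam : ℂ) (a N : ℕ) (m : ℤ) (f : ℤ → ℂ[X]) (j : ℤ) (n : ℕ) : Prop :=
  ec (f j) (n + 2) + ((n : ℂ) - a - m + j) * (n + a + m + j + 2 * lam - 2) * ec (f j) n
    + 2 * ((N : ℂ) - j) * ec (f (j + 1)) (n + 1) = 0

/-- Recurrence `A'`. -/
def RecA' (lam : ℂ) (a N : ℕ) (m : ℤ) (f : ℤ → ℂ[X]) (j : ℤ) (n : ℕ) : Prop :=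
  ec (f j) (n + 2) + ((n : ℂ) - a + m - j) * (n + a - m - j + 2 * lam - 2) * ec (f j) n
    - 2 * ((N : ℂ) + j) * ec (f (j - 1)) (n + 1) = 0

lemma Xi_iff (lam : ℂ) (a N : ℕ) (m : ℤ) (f : ℤ → ℂ[X]) :
    f ∈ XiSet lam a N m ↔ (∀ j : ℤ, (N : ℤ) < |j| → f j = 0) ∧
    (∀ j : ℤ, |j| ≤ (N : ℤ) → polEven ((a : ℤ) - m + j) (f j)) ∧
    (∀ j : ℤ, |j| ≤ (N : ℤ) → ∀ n : ℕ, RecA lam a N m f j n ∧ RecA' lam a N m f j n) := by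
  unfold XiSet
  simp only [Set.mem_setOf_eq, poly_zero_iff, ec_add, ec_sub, ec_C_mul, ec_gegenS, ec_der, euler,
    ec_Xder]
  refine and_congr Iff.rfl (and_congr Iff.rfl ?_)
  unfold RecA RecA'
  constructor
  · rintro ⟨hA, hA', hB, hB'⟩ j hj n
    rw [abs_le] at hj
    rcases le_or_gt j 0 with h | h
    · have h1 := hA' (-j) (by omega) (by omega) n
      rw [neg_neg] at h1
      rcases eq_or_lt_of_le h with h0 | h0
      · subst h0
        have h2 := hA 0 (by omega) (by omega) n
        push_cast at h1 h2 ⊢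
        constructor
        · linear_combination -h2
        · linear_combination -h1
      · have h2 := hB' (-j) (by omega) (by omega) n
        rw [neg_neg] at h2
        push_cast at h1 h2 ⊢
        constructor
        · linear_combination -h1 - 2 * h2
        · linear_combination -h1
    · have h1 := hA j (by omega) (by omega) n
      have h2 := hB j (by omega) (by omega) n
      push_cast at h1 h2 ⊢
      constructor
      · linear_combination -h1
      · linear_combination -h1 - 2 * h2
  · intro H
    refine ⟨?_, ?_, ?_, ?_⟩
    · intro j h1 h2 n
      have h := (H j (abs_le.2 ⟨by omega, h2⟩) n).1
      push_cast
      linear_combination -h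
    · intro j h1 h2 n
      have h := (H (-j) (abs_le.2 ⟨by omega, by omega⟩) n).2
      push_cast at h ⊢
      linear_combination -h
    · intro j h1 h2 n
      obtain ⟨h, h'⟩ := H j (abs_le.2 ⟨by omega, by omega⟩) n
      linear_combination (h - h') / 2
    · intro j h1 h2 n
      obtain ⟨h, h'⟩ := H (-j) (abs_le.2 ⟨by omega, by omega⟩) n
      push_cast at h h' ⊢
      linear_combination (h' - h) / 2

lemma F1_mem (N a : ℕ) (m q : ℤ) (hm : (N : ℤ) < m)
    (hq : 0 ≤ q) (hq1 : (N : ℤ) - a + m ≤ q) (hq2 : q ≤ 2 * N) :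
    F1 N a m q ∈ XiSet (((N : ℤ) + 1 - a - q : ℤ) : ℂ) a N m := by
  have F := F1_ec N a m q hm hq hq1 hq2
  rw [Xi_iff]
  refine ⟨F1_out N a m q, ?_, ?_⟩
  · intro j hj n hn
    by_cases h : ∃ k : ℤ, (n : ℤ) = a - m + j - 2 * k
    · obtain ⟨k, hk⟩ := h
      have hk0 : 0 ≤ k := by
        by_contra hneg
        apply hn
        rw [← ec_eq_zero, F j hj n k hk, EZ_neg _ _ _ _ (by omega), mul_zero]
      exact ⟨by omega, ⟨k, by omega⟩⟩
    · exact absurd (ec_eq_zero.1 (F1_par N a m q j n h)) hn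
  · intro j hj n
    have hj' := abs_le.1 hj
    unfold RecA RecA'
    by_cases h : ∃ k : ℤ, (n : ℤ) = a - m + j - 2 * k
    · obtain ⟨k, hk⟩ := h
      have hnC : (n : ℂ) = a - m + j - 2 * k := by exact_mod_cast hk
      have c1 := F j hj n k hk
      have c2 := F j hj (n + 2) (k - 1) (by push_cast; omega)
      rw [c1, c2]
      constructor
      · have A := EZ_A N m q hm hq hq2 k j hj'.2
        have c3 : 2 * ((N : ℂ) - j) * ec (F1 N a m q (j + 1)) (n + 1) =
            2 * ((N : ℂ) - j) * (KK N a m q * EZ N m q (j + 1) k) := by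
          rcases eq_or_lt_of_le hj'.2 with e | e
          · subst e; simp
          · rw [F (j + 1) (abs_le.2 ⟨by omega, by omega⟩) (n + 1) k (by push_cast; omega)]
        rw [c3, hnC]
        push_cast
        linear_combination KK N a m q * A
      · have A := EZ_A' N m q hm hq k j
        have c3 : 2 * ((N : ℂ) + j) * ec (F1 N a m q (j - 1)) (n + 1) =
            2 * ((N : ℂ) + j) * (KK N a m q * EZ N m q (j - 1) (k - 1)) := by
          rcases eq_or_lt_of_le hj'.1 with e | e
          · rw [← e]; simp
          · rw [F (j - 1) (abs_le.2 ⟨by omega, by omega⟩) (n + 1) (k - 1) (by push_cast; omega)]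
        rw [c3, hnC]
        push_cast
        linear_combination KK N a m q * A
    · rw [F1_par N a m q j n h, F1_par N a m q j (n + 2), F1_par N a m q (j + 1) (n + 1),
        F1_par N a m q (j - 1) (n + 1)]
      · simp
      · rintro ⟨k, hk⟩; exact h ⟨k + 1, by push_cast at hk; linarith⟩
      · rintro ⟨k, hk⟩; exact h ⟨k, by push_cast at hk; linarith⟩
      · rintro ⟨k, hk⟩; exact h ⟨k + 1, by push_cast at hk; linarith⟩

lemma Xi_sub (lam : ℂ) (a N : ℕ) (m : ℤ) (f g : ℤ → ℂ[X]) (c : ℂ)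
    (hf : f ∈ XiSet lam a N m) (hg : g ∈ XiSet lam a N m) :
    (fun j => g j - C c * f j) ∈ XiSet lam a N m := by
  rw [Xi_iff] at *
  obtain ⟨f1, f2, f3⟩ := hf
  obtain ⟨g1, g2, g3⟩ := hg
  refine ⟨fun j hj => by simp [f1 j hj, g1 j hj], ?_, ?_⟩
  · intro j hj n hn
    by_cases h : (f j).coeff n = 0
    · apply g2 j hj n
      intro h'
      apply hn
      simp [h, h']
    · exact f2 j hj n h
  · intro j hj n
    obtain ⟨p1, p2⟩ := f3 j hj n
    obtain ⟨q1, q2⟩ := g3 j hj n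
    unfold RecA RecA' at *
    simp only [ec_sub, ec_C_mul]
    constructor
    · linear_combination q1 - c * p1
    · linear_combination q2 - c * p2

/-- Uniqueness. -/
lemma Xi_unique (N a : ℕ) (m q : ℤ) (hm : (N : ℤ) < m)
    (hq : 0 ≤ q) (hq1 : (N : ℤ) - a + m ≤ q) (hq2 : q ≤ 2 * N) (g : ℤ → ℂ[X])
    (hg : g ∈ XiSet (((N : ℤ) + 1 - a - q : ℤ) : ℂ) a N m)
    (h0 : ∀ n : ℕ, (n : ℤ) = a - m + (q - N) → ec (g (q - N)) n = 0) : g = 0 := by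
  rw [Xi_iff] at hg
  obtain ⟨g1, g2, g3⟩ := hg
  have van : ∀ j : ℤ, |j| ≤ N → ∀ n : ℕ, (a : ℤ) - m + j < n → ec (g j) n = 0 := by
    intro j hj n hn
    rw [ec_eq_zero]
    by_contra hne
    have := (g2 j hj n hne).1
    omega
  have par : ∀ j : ℤ, |j| ≤ N → ∀ n : ℕ, (¬ ∃ k : ℤ, (n : ℤ) = a - m + j - 2 * k) →
      ec (g j) n = 0 := by
    intro j hj n hn
    rw [ec_eq_zero]
    by_contra hne
    obtain ⟨k, hk⟩ := (g2 j hj n hne).2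
    exact hn ⟨k, by omega⟩
  -- the top recurrence
  have top : ∀ j : ℤ, -N ≤ j → j ≤ N → ∀ n : ℕ, (n : ℤ) = a - m + j →
      2 * ((j : ℂ) - m) * ((N : ℂ) - q + j) * ec (g j) n + ((N : ℂ) - j) * ec (g (j + 1)) (n + 1) = 0 := by
    intro j h1 h2 n hn
    have hj : |j| ≤ N := abs_le.2 ⟨h1, h2⟩
    have h := (g3 j hj n).1
    unfold RecA at h
    rw [van j hj (n + 2) (by push_cast; omega)] at h
    have hnC : (n : ℂ) = a - m + j := by exact_mod_cast hn
    rw [hnC] at h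
    push_cast at h
    linear_combination h / 2
  have up : ∀ d : ℕ, ∀ j : ℤ, j = N - d → q - N < j → ∀ n : ℕ, (n : ℤ) = a - m + j →
      ec (g j) n = 0 := by
    intro d
    induction d with
    | zero =>
      intro j hj hqj n hn
      have h := top j (by omega) (by omega) n hn
      have d1 : (N : ℂ) - q + j ≠ 0 := by
        have : (N : ℤ) - q + j ≠ 0 := by omega
        exact_mod_cast this
      have d2 : (j : ℂ) - m ≠ 0 := by
        have : j - m ≠ 0 := by omega
        exact_mod_cast this
      have hjC : (j : ℂ) = N := by simp [hj]
      apply mul_left_cancel₀ (mul_ne_zero d2 d1)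
      linear_combination h / 2 + (ec (g (j + 1)) (n + 1)) / 2 * hjC
    | succ d ih =>
      intro j hj hqj n hn
      have h := top j (by omega) (by omega) n hn
      rw [ih (j + 1) (by push_cast at hj; omega) (by omega) (n + 1) (by push_cast; omega)] at h
      have d1 : (N : ℂ) - q + j ≠ 0 := by
        have : (N : ℤ) - q + j ≠ 0 := by omega
        exact_mod_cast this
      have d2 : (j : ℂ) - m ≠ 0 := by
        have : j - m ≠ 0 := by omega
        exact_mod_cast this
      apply mul_left_cancel₀ (mul_ne_zero d2 d1)
      linear_combination h / 2
  have down : ∀ d : ℕ, ∀ j : ℤ, j = q - N - d → -N ≤ j → ∀ n : ℕ, (n : ℤ) = a - m + j →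
      ec (g j) n = 0 := by
    intro d
    induction d with
    | zero =>
      intro j hj h1 n hn
      obtain rfl : j = q - N := by simpa using hj
      exact h0 n hn
    | succ d ih =>
      intro j hj h1 n hn
      push_cast at hj
      have h := top j (by omega) (by omega) n hn
      rw [ih (j + 1) (by omega) (by omega) (n + 1) (by push_cast; omega)] at h
      have d1 : (N : ℂ) - q + j ≠ 0 := by
        have : (N : ℤ) - q + j ≠ 0 := by omega
        exact_mod_cast this
      have d2 : (j : ℂ) - m ≠ 0 := by
        have : j - m ≠ 0 := by omega
        exact_mod_cast this
      apply mul_left_cancel₀ (mul_ne_zero d2 d1)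
      linear_combination h / 2
  have all : ∀ k : ℕ, ∀ j : ℤ, |j| ≤ N → ∀ n : ℕ, (n : ℤ) = a - m + j - 2 * k → ec (g j) n = 0 := by
    intro k
    induction k with
    | zero =>
      intro j hj n hn
      have hj' := abs_le.1 hj
      rcases lt_or_ge (q - N) j with h | h
      · exact up (N - j).toNat j (by omega) h n (by push_cast at hn; omega)
      · exact down (q - N - j).toNat j (by omega) hj'.1 n (by push_cast at hn; omega)
    | succ k ih =>
      intro j hj n hn
      have hj' := abs_le.1 hj
      have h := (g3 j hj n).2
      unfold RecA' at h
      rw [ih j hj (n + 2) (by push_cast at hn ⊢; omega)] at h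
      have c3 : 2 * ((N : ℂ) + j) * ec (g (j - 1)) (n + 1) = 0 := by
        rcases eq_or_lt_of_le hj'.1 with e | e
        · rw [← e]; simp
        · rw [ih (j - 1) (abs_le.2 ⟨by omega, by omega⟩) (n + 1) (by push_cast at hn ⊢; omega), mul_zero]
      rw [c3] at h
      have hnC : (n : ℂ) = a - m + j - 2 * (k + 1) := by exact_mod_cast hn
      have d1 := den_ne N m q hm hq k
      have d2 : (k : ℂ) + 1 ≠ 0 := by exact_mod_cast Nat.succ_ne_zero k
      apply mul_left_cancel₀ (mul_ne_zero d2 d1)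
      rw [hnC] at h
      push_cast at h
      linear_combination -h / 4
  funext j
  rcases lt_or_ge (N : ℤ) |j| with hj | hj
  · exact g1 j hj
  · show g j = 0
    rw [poly_zero_iff]
    intro n
    by_cases h : ∃ k : ℤ, (n : ℤ) = a - m + j - 2 * k
    · obtain ⟨k, hk⟩ := h
      rcases lt_or_ge k 0 with h | h
      · exact van j hj n (by omega)
      · obtain ⟨K, rfl⟩ := Int.eq_ofNat_of_zero_le h
        exact all K j hj n hk
    · exact par j hj n h

/-- for `λ = N+1-a-q ∈ Λ(N,a,m)` and `ν = λ+a`, the space `Ξ(λ,a,N,m)` is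
one-dimensional, spanned by the explicit tuple `F1 N a m q`. -/
theorem stmt1 (N a : ℕ) (m : ℤ) (hm : (N : ℤ) < m) (ha : m - (N : ℤ) ≤ (a : ℤ))
    (q : ℤ) (hq1 : max 0 ((N : ℤ) - a + m) ≤ q) (hq2 : q ≤ 2 * N) :
    F1 N a m q ∈ XiSet (((N : ℤ) + 1 - a - q : ℤ) : ℂ) a N m ∧
    F1 N a m q ≠ 0 ∧
    ∀ g ∈ XiSet (((N : ℤ) + 1 - a - q : ℤ) : ℂ) a N m, ∃ c : ℂ, g = c • F1 N a m q := by
  have hq : 0 ≤ q := le_trans (le_max_left _ _) hq1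
  have hq1' : (N : ℤ) - a + m ≤ q := le_trans (le_max_right _ _) hq1
  have hmem := F1_mem N a m q hm hq hq1' hq2
  obtain ⟨n₀, hn₀⟩ : ∃ n : ℕ, (n : ℤ) = a - m + (q - N) := ⟨((a : ℤ) - m + (q - N)).toNat, by omega⟩
  have hne : ec (F1 N a m q (q - N)) n₀ ≠ 0 := by
    rw [F1_ec N a m q hm hq hq1' hq2 (q - N) (abs_le.2 ⟨by omega, by omega⟩) n₀ 0 (by omega)]
    have e := EZ_nat N m q (q - N) 0
    rw [Nat.cast_zero] at e
    rw [e]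
    have fne : ∀ x : ℕ, (x.factorial : ℂ) ≠ 0 := fun x => by exact_mod_cast x.factorial_ne_zero
    refine mul_ne_zero ?_ ?_
    · unfold KK
      refine mul_ne_zero (mul_ne_zero (mul_ne_zero (zpow_ne_zero _ Complex.I_ne_zero)
        (zpow_ne_zero _ (by norm_num))) (zpow_ne_zero _ (by norm_num))) (div_ne_zero
        (mul_ne_zero (fne _) (fne _)) (mul_ne_zero (gg_ne (by omega)) (fne _)))
    · simp only [EN, E0]
      exact mul_ne_zero (gg_ne (by omega)) (mul_ne_zero (mul_ne_zero (mul_ne_zero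
        (zpow_ne_zero _ (by norm_num)) (fne _)) (rf_ne (by omega))) (rf_ne (by omega)))
  refine ⟨hmem, ?_, ?_⟩
  · intro h
    apply hne
    rw [h]
    exact ec_zero _
  · intro g hg
    refine ⟨ec (g (q - N)) n₀ / ec (F1 N a m q (q - N)) n₀, ?_⟩
    have h := Xi_unique N a m q hm hq hq1' hq2 _
      (Xi_sub _ a N m _ g (ec (g (q - N)) n₀ / ec (F1 N a m q (q - N)) n₀) hmem hg) (by
        intro n hn
        obtain rfl : n = n₀ := by omega
        rw [ec_sub, ec_C_mul]
        field_simp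
        ring)
    funext j
    have hj := congrFun h j
    simp only [Pi.zero_apply] at hj
    rw [Pi.smul_apply, smul_eq_C_mul]
    exact sub_eq_zero.1 hj
end
end

section
/- Let λ ∈ ℂ, a, N ∈ ℕ and m ∈ ℤ with m > N and a ≥ m−N. If Γ_0^- = 0, that is, if γ(λ+N-1, a-m-N-d) = 0 for some d ∈ {1,…,N}, then Ξ(λ,a,N,m) = {0}. -/
noncomputable section

open Polynomial Finset

theorem gegenS_coeff_aux (μ : ℂ) (ℓ : ℤ) (f : ℂ[X]) (n : ℕ) :
    (gegenS μ ℓ f).coeff n = -(((n : ℂ) + 2) * ((n : ℂ) + 1) * f.coeff (n + 2)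
      + ((n : ℂ) - ℓ) * ((n : ℂ) + ℓ + 2 * μ) * f.coeff n) := by
  have e : gegenS μ ℓ f = -(derivative (derivative f) + X ^ 2 * derivative (derivative f)
      + C (1 + 2 * μ) * (X * derivative f) - C ((ℓ : ℂ) * ((ℓ : ℂ) + 2 * μ)) * f) := by
    unfold gegenS
    have : (C (1 + 2 * μ) : ℂ[X]) = 1 + 2 * C μ := by
      rw [C_add, C_mul, C_1]; rfl
    rw [this]
    ring
  rw [e]
  simp only [coeff_neg, coeff_add, coeff_sub, coeff_C_mul, coeff_derivative]
  rcases n with _ | _ | n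
  · simp [coeff_X_pow_mul', coeff_X_mul_zero]
    ring
  · rw [coeff_X_pow_mul', coeff_X_mul]
    simp [coeff_derivative]
    ring
  · rw [coeff_X_pow_mul, coeff_X_mul]
    simp only [coeff_derivative]
    push_cast
    ring

theorem gegenS_inj_aux (μ : ℂ) (ℓ : ℤ) (f : ℂ[X]) (h0 : gegenS μ ℓ f = 0)
    (h : ∀ n : ℕ, f.coeff n ≠ 0 → ((n : ℂ) - ℓ) * ((n : ℂ) + ℓ + 2 * μ) ≠ 0) : f = 0 := by
  by_contra hf
  have hc : f.coeff f.natDegree ≠ 0 := by simpa using hf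
  have h1 := gegenS_coeff_aux μ ℓ f f.natDegree
  rw [h0, coeff_eq_zero_of_natDegree_lt (show f.natDegree < f.natDegree + 2 by omega)] at h1
  simp only [coeff_zero, mul_zero, zero_add] at h1
  exact mul_ne_zero (h _ hc) hc (by linear_combination h1)

/-- if `Γ_0^- = 0`, i.e. `γ(λ+N-1, a-m-N-d) = 0` for some `1 ≤ d ≤ N`,
then `Ξ(λ,a,N,m) = {0}`. -/
theorem stmt5 (lam : ℂ) (a N : ℕ) (m : ℤ) (hm : (N : ℤ) < m) (ha : m - (N : ℤ) ≤ (a : ℤ))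
    (h : ∃ d : ℕ, 1 ≤ d ∧ d ≤ N ∧
      gam (lam + (N : ℂ) - 1) ((a : ℤ) - m - (N : ℤ) - (d : ℤ)) = 0) :
    XiSet lam a N m = {0} := by
  obtain ⟨d, hd1, hdN, hg⟩ := h
  have hlam : 2 * lam = 2 + (m : ℂ) + d - a - N := by
    unfold gam at hg
    split_ifs at hg with hpar
    · have h2 : (2 : ℤ) * (((a : ℤ) - m - N - d) / 2) = (a : ℤ) - m - N - d := by omega
      have h3 : (2 : ℂ) * (((((a : ℤ) - m - N - d) / 2 : ℤ)) : ℂ) = (a : ℂ) - m - N - d := by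
        exact_mod_cast congrArg (Int.cast : ℤ → ℂ) h2
      linear_combination 2 * hg - h3
    · exact absurd hg one_ne_zero
  apply Set.eq_singleton_iff_unique_mem.2
  constructor
  · refine ⟨fun _ _ => rfl, fun _ _ n hn => absurd rfl hn, ?_, ?_, ?_, ?_⟩ <;>
      intros <;> simp [gegenS, euler]
  rintro f ⟨hout, hpol, hAp, hAm, -, hBm⟩
  -- the nonnegative half
  have hpos : ∀ k : ℕ, k ≤ N + 1 → f ((N : ℤ) + 1 - k) = 0 := by
    intro k
    induction k with
    | zero =>
      intro _
      apply hout
      rw [abs_of_nonneg (by push_cast; omega)]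
      push_cast
      omega
    | succ k ih =>
      intro hk
      have ih' := ih (by omega)
      obtain ⟨j, hj⟩ : ∃ j : ℤ, j = (N : ℤ) - k := ⟨_, rfl⟩
      have e1 : (N : ℤ) + 1 - ((k + 1 : ℕ) : ℤ) = j := by push_cast; omega
      have e2 : (N : ℤ) + 1 - k = j + 1 := by omega
      rw [e2] at ih'
      rw [e1]
      have hj0 : 0 ≤ j := by omega
      have hjN : j ≤ N := by omega
      have hA := hAp j hj0 hjN
      rw [ih', derivative_zero, mul_zero, sub_zero] at hA
      apply gegenS_inj_aux _ _ _ hA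
      intro n hn
      obtain ⟨hle, -⟩ := hpol j (by rw [abs_of_nonneg hj0]; exact hjN) n hn
      have hz : ((n : ℤ) - (a + m - j)) * (n + 2 * m + d - N + j) ≠ 0 :=
        mul_ne_zero (by omega) (by omega)
      have hz' : (((n : ℤ) - (a + m - j) : ℤ) : ℂ) * ((n + 2 * m + d - N + j : ℤ) : ℂ) ≠ 0 := by
        exact_mod_cast hz
      convert hz' using 1
      push_cast
      linear_combination ((n : ℂ) - (a + m - j)) * hlam
  have hneg : ∀ k : ℕ, k ≤ N → f (-(k : ℤ)) = 0 := by
    intro k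
    induction k with
    | zero =>
      intro _
      have := hpos (N + 1) le_rfl
      simpa using this
    | succ k ih =>
      intro hk
      have ih' := ih (by omega)
      obtain ⟨j, hj⟩ : ∃ j : ℤ, j = (k : ℤ) + 1 := ⟨_, rfl⟩
      have hA0 := hAm k (by omega) (by omega)
      have e0 : -(k : ℤ) - 1 = -j := by omega
      have e1 : -((k + 1 : ℕ) : ℤ) = -j := by push_cast; omega
      have e2 : -j + 1 = -(k : ℤ) := by omega
      rw [e1]
      rw [ih', e0] at hA0
      have hNk : (2 * ((N : ℂ) - ((k : ℤ) : ℂ))) ≠ 0 := by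
        have : (2 * ((N : ℤ) - (k : ℤ))) ≠ 0 := by omega
        exact_mod_cast this
      have hder : derivative (f (-j)) = 0 := by
        have h0 : ∀ μ ℓ, gegenS μ ℓ 0 = 0 := by intro μ ℓ; simp [gegenS]
        rw [h0, zero_add] at hA0
        rcases mul_eq_zero.1 hA0 with h1 | h1
        · exact absurd (C_eq_zero.1 h1) hNk
        · exact h1
      have hA := hAm j (by omega) (by omega)
      have hB := hBm j (by omega) (by omega)
      rw [e2, ih'] at hB
      simp only [gegenS, euler, hder, derivative_zero, mul_zero, add_zero, zero_add, zero_sub,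
        sub_zero, neg_neg] at hA hB
      have hz : ((a : ℤ) + m + j) * (2 * m + d - N - j) ≠ 0 :=
        mul_ne_zero (by omega) (by omega)
      have hz' : (((a : ℤ) + m + j : ℤ) : ℂ) * ((2 * m + d - N - j : ℤ) : ℂ) ≠ 0 := by
        exact_mod_cast hz
      have key : C ((((a : ℤ) + m + j : ℤ) : ℂ) * ((2 * m + d - N - j : ℤ) : ℂ)) * f (-j) = 0 := by
        have e : (((a : ℤ) + m + j : ℤ) : ℂ) * ((2 * m + d - N - j : ℤ) : ℂ)
            = (((a : ℤ) - m - j : ℤ) : ℂ) * ((((a : ℤ) - m - j : ℤ) : ℂ) + 2 * (lam + (j : ℂ) - 1))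
              + 2 * (2 * (m : ℂ) * (lam + (a : ℂ) - 1)) + 2 * (2 * (j : ℂ) * (lam - 1)) := by
          push_cast
          linear_combination (-(a : ℂ) - m - j) * hlam
        rw [e]
        simp only [C_add, C_mul, C_sub] at hA hB ⊢
        linear_combination hA + C 2 * hB
      rcases mul_eq_zero.1 key with h1 | h1
      · exact absurd (C_eq_zero.1 h1) hz'
      · exact h1
  funext j
  by_cases hj : (N : ℤ) < |j|
  · exact hout j hj
  rw [not_lt, abs_le] at hj
  rcases le_total 0 j with h0 | h0
  · have := hpos ((N : ℤ) + 1 - j).toNat (by omega)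
    rwa [show (N : ℤ) + 1 - (((N : ℤ) + 1 - j).toNat : ℤ) = j by omega] at this
  · have := hneg (-j).toNat (by omega)
    rwa [show -(((-j).toNat : ℕ) : ℤ) = j by omega] at this
end
end
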